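/- arXiv:dg-ga/9706012 — 3 statements merged into one kernel-verified Lean document; each statement's English description precedes it below -/
import Mathlib

section
/- Let F be a field and let (C_*, ∂) be a finite acyclic chain complex of finite-dimensional F-vector spaces with ordered basis e. Suppose (A_*, B_*) and (A'_*, B'_*) are two decompositions C_i = A_i ⊕ B_i = A'_i ⊕ B'_i such that in each case the summands are spanned by subsets of the basis e_i and the maps π_{B_{i-1}} ∘ ∂|_{A_i} : A_i → B_{i-1} and π_{B'_{i-1}} ∘ ∂|_{A'_i} : A'_i → B'_{i-1} are isomorphisms for every i. Then ∏_i det(π_{B_{i-1}} ∘ ∂|_{A_i})^{(-1)^i} = ± ∏_i det(π_{B'_{i-1}} ∘ ∂|_{A'_i})^{(-1)^i}, where each determinant is computed with respect to the relevant subbases of e. -/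
open Module Submodule

noncomputable section

variable (F : Type) [Field F]

/-- The determinant of a finite family of vectors with respect to a basis, computed after an
arbitrary identification of the index types (this only affects the result up to sign). -/
def detFam {M ι κ : Type} [AddCommGroup M] [Module F M] [Fintype ι] [Fintype κ]
    (e : Basis ι F M) (v : κ → M) : F :=
  letI := Classical.propDecidable
  if hc : Nonempty (κ ≃ ι) then
    letI := Classical.decEq ι
    Basis.det e (v ∘ (Classical.choice hc).symm)
  else 0

/-- The determinant of a linear map with respect to bases of its domain and codomain. -/
def detMap {M N ι κ : Type} [AddCommGroup M] [Module F M] [AddCommGroup N] [Module F N]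
    [Fintype κ] [Fintype ι] (bM : Basis κ F M) (bN : Basis ι F N) (f : M →ₗ[F] N) : F :=
  detFam F bN fun j => f (bM j)

/-- The basis of the span of a subset of a basis, given by the corresponding basis vectors. -/
def subBasis {M ι : Type} [AddCommGroup M] [Module F M] (e : Basis ι F M) (S : Finset ι) :
    Basis {j // j ∈ S} F ↥(span F (⇑e '' ↑S)) :=
  (Basis.span ((e.linearIndependent).comp (fun j : {j // j ∈ S} => (j : ι))
    Subtype.val_injective)).map
    (LinearEquiv.ofEq _ _ (by rw [Set.range_comp]; congr 1; ext x; simp))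

section ChainComplex

variable (C : ℕ → Type) [∀ i, AddCommGroup (C i)] [∀ i, Module F (C i)]
  (d : ∀ i, C (i + 1) →ₗ[F] C i)

/-- The cycles `Z_i` of the chain complex `(C_*, ∂)`; by convention `Z_0 = C_0`. -/
def cyc : ∀ i : ℕ, Submodule F (C i)
  | 0 => ⊤
  | (i + 1) => LinearMap.ker (d i)

/-- The boundaries `B_i = im ∂_{i+1}` of the chain complex `(C_*, ∂)`. -/
def bdry (i : ℕ) : Submodule F (C i) := LinearMap.range (d i)

variable {ι : ℕ → Type} [∀ i, Fintype (ι i)] (e : ∀ i, Basis (ι i) F (C i))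
  (S T : ∀ i, Finset (ι i))

/-- The composition `π_{B_i} ∘ ∂|_{A_{i+1}} : A_{i+1} → B_i`, where `A_i = span(e_i(S_i))` and
`B_i = span(e_i(T_i))` form a direct sum decomposition of `C_i`, and `π_{B_i}` is the projection
onto `B_i` along `A_i`. -/
def projBoundary
    (hcompl : ∀ i, IsCompl (span F (⇑(e i) '' ↑(S i))) (span F (⇑(e i) '' ↑(T i)))) (i : ℕ) :
    ↥(span F (⇑(e (i + 1)) '' ↑(S (i + 1)))) →ₗ[F] ↥(span F (⇑(e i) '' ↑(T i))) :=
  (Submodule.linearProjOfIsCompl (span F (⇑(e i) '' ↑(T i))) (span F (⇑(e i) '' ↑(S i)))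
      (hcompl i).symm).comp
    ((d i).comp (span F (⇑(e (i + 1)) '' ↑(S (i + 1)))).subtype)

/-- The alternating product `Π_i det(π_{B_{i-1}} ∘ ∂|_{A_i})^{(-1)^i}` of the determinants of
the maps `π_{B_{i-1}} ∘ ∂|_{A_i} : A_i → B_{i-1}`, computed in the subbases of `e` indexed by
`S_i` and `T_{i-1}` respectively (the factor for `i = 0` is trivial since `B_{-1} = 0`). -/
def altProd
    (hcompl : ∀ i, IsCompl (span F (⇑(e i) '' ↑(S i))) (span F (⇑(e i) '' ↑(T i))))
    (n : ℕ) : F :=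
  ∏ i ∈ Finset.range (n + 1),
    (detMap F (subBasis F (e (i + 1)) (S (i + 1))) (subBasis F (e i) (T i))
        (projBoundary F C d e S T hcompl i)) ^ ((-1 : ℤ) ^ (i + 1))

end ChainComplex

section Determinants

variable {F} {M ι κ κ' : Type} [AddCommGroup M] [Module F M]

lemma subBasis_apply (e : Basis ι F M) (S : Finset ι) (j : {j // j ∈ S}) :
    (subBasis F e S j : M) = e j := by
  simp [subBasis, Basis.span_apply]

variable [Fintype ι] [Fintype κ] [Fintype κ']

/-- A reindexing changes a determinant by a sign. -/
lemma detFam_sq [DecidableEq ι] (e : Basis ι F M) (v : κ → M) (τ : ι ≃ κ) :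
    detFam F e v ^ 2 = e.det (v ∘ τ) ^ 2 := by
  classical
  have hc : Nonempty (κ ≃ ι) := ⟨τ.symm⟩
  have hv : v ∘ (Classical.choice hc).symm
      = (v ∘ τ) ∘ ((Classical.choice hc).symm.trans τ.symm) := by
    ext x; simp
  unfold detFam
  rw [dif_pos hc, hv]
  have hperm := e.det.map_perm (v ∘ τ) ((Classical.choice hc).symm.trans τ.symm)
  rcases Int.units_eq_one_or
    (Equiv.Perm.sign ((Classical.choice hc).symm.trans τ.symm)) with h | h <;>
    rw [h] at hperm
  · rw [one_smul] at hperm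
    convert congrArg (· ^ 2) hperm
  · rw [Units.neg_smul, one_smul] at hperm
    rw [← neg_sq (e.det (v ∘ τ))]
    convert congrArg (· ^ 2) hperm

lemma detFam_comp_equiv_sq (e : Basis ι F M) (v : κ → M) (σ : κ' ≃ κ) :
    detFam F e (v ∘ σ) ^ 2 = detFam F e v ^ 2 := by
  classical
  by_cases hc : Nonempty (ι ≃ κ)
  · obtain ⟨τ⟩ := hc
    rw [detFam_sq e v τ, detFam_sq e (v ∘ σ) (τ.trans σ.symm)]
    congr 2
    ext x; simp
  · have h1 : ¬ Nonempty (κ ≃ ι) := fun ⟨τ⟩ => hc ⟨τ.symm⟩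
    have h2 : ¬ Nonempty (κ' ≃ ι) := fun ⟨τ⟩ => hc ⟨τ.symm.trans σ⟩
    simp only [detFam, dif_neg h1, dif_neg h2]

lemma detFam_reindex_sq (e : Basis ι F M) (f : ι ≃ κ') (v : κ → M) :
    detFam F (e.reindex f) v ^ 2 = detFam F e v ^ 2 := by
  classical
  by_cases hc : Nonempty (ι ≃ κ)
  · obtain ⟨τ⟩ := hc
    rw [detFam_sq e v τ, detFam_sq (e.reindex f) v (f.symm.trans τ), Basis.det_reindex]
    congr 2
    ext x; simp
  · have h1 : ¬ Nonempty (κ ≃ ι) := fun ⟨τ⟩ => hc ⟨τ.symm⟩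
    have h2 : ¬ Nonempty (κ ≃ κ') := fun ⟨τ⟩ => hc ⟨f.trans τ.symm⟩
    simp only [detFam, dif_neg h1, dif_neg h2]

/-- Applying a square matrix to a family multiplies its determinant by that of the matrix. -/
lemma detFam_sum_smul_sq [DecidableEq κ] (e : Basis ι F M) (v w : κ → M) (P : Matrix κ κ F)
    (h : ∀ k, w k = ∑ j, P j k • v j) :
    detFam F e w ^ 2 = detFam F e v ^ 2 * P.det ^ 2 := by
  classical
  by_cases hc : Nonempty (ι ≃ κ)
  · obtain ⟨τ⟩ := hc
    rw [detFam_sq e w τ, detFam_sq e v τ, ← mul_pow]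
    congr 1
    rw [← Matrix.det_submatrix_equiv_self τ P, Basis.det_apply, Basis.det_apply,
      ← Matrix.det_mul]
    congr 1
    ext a b
    simp only [Basis.toMatrix_apply, Function.comp_apply, h, map_sum, map_smul,
      Finsupp.coe_finsetSum, Finset.sum_apply, Finsupp.smul_apply, smul_eq_mul,
      Matrix.mul_apply, Matrix.submatrix_apply]
    rw [← τ.sum_comp]
    exact Finset.sum_congr rfl fun _ _ => mul_comm _ _
  · have h1 : ¬ Nonempty (κ ≃ ι) := fun ⟨τ⟩ => hc ⟨τ.symm⟩
    simp only [detFam, dif_neg h1]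
    simp

lemma detMap_ne_zero {N : Type} [AddCommGroup N] [Module F N] (bM : Basis κ F M)
    (bN : Basis ι F N) (f : M →ₗ[F] N) (hf : Function.Bijective f) :
    detMap F bM bN f ≠ 0 := by
  classical
  let b := bM.map (LinearEquiv.ofBijective f hf)
  let τ : ι ≃ κ := bN.indexEquiv b
  have h : detMap F bM bN f ^ 2 = bN.det (b.reindex τ.symm) ^ 2 := by
    rw [detMap, detFam_sq bN _ τ]
    congr 2
    ext x; simp [b]
  intro h0
  rw [h0] at h
  exact (bN.isUnit_det (b.reindex τ.symm)).ne_zero (by simpa using h.symm)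

/-- The block triangular determinant of the vectors `e_s`, `s ∈ S`, together with a family `w`
equals the determinant of the projection of `w` to the complementary coordinate subspace. -/
lemma detFam_sumElim_sq (e : Basis ι F M) (S T : Finset ι)
    (h : IsCompl (span F (⇑e '' ↑S)) (span F (⇑e '' ↑T))) (w : κ → M) (σ : {j // j ∈ T} ≃ κ) :
    detFam F e (Sum.elim (fun j : {j // j ∈ S} => e j) w) ^ 2 =
      detFam F (subBasis F e T) (fun k => Submodule.projectionOnto _ _ h.symm (w k)) ^ 2 := by
  classical
  let g := ((subBasis F e S).prod (subBasis F e T)).map (Submodule.prodEquivOfIsCompl _ _ h)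
  let f : {j // j ∈ S} ⊕ {j // j ∈ T} → ι := Sum.elim (fun j => j) (fun j => j)
  have hg : ∀ x, g x = e (f x) := by
    rintro (x | x) <;> simp [g, f, subBasis_apply]
  have hf : Function.Bijective f := by
    rw [Fintype.bijective_iff_injective_and_card]
    refine ⟨fun x y hxy => g.injective (by rw [hg, hg, hxy]), ?_⟩
    exact Fintype.card_congr (g.indexEquiv e)
  have he : e = g.reindex (Equiv.ofBijective f hf) := by
    refine Basis.eq_of_apply_eq fun j => ?_
    rw [Basis.reindex_apply, hg]
    exact congrArg e ((Equiv.ofBijective f hf).apply_symm_apply j).symm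
  have hcoe : (Sum.elim (fun j : {j // j ∈ S} => e j) w) = Sum.elim (fun j => g (Sum.inl j)) w := by
    ext x
    rcases x with x | x <;> simp [hg, f]
  rw [hcoe]
  conv_lhs => rw [he]
  rw [detFam_reindex_sq, detFam_sq g _ (Equiv.sumCongr (Equiv.refl _) σ), detFam_sq _ _ σ,
    Basis.det_apply, Basis.det_apply]
  congr 1
  have hM : g.toMatrix (Sum.elim (fun j => g (Sum.inl j)) w ∘ (Equiv.sumCongr (Equiv.refl _) σ)) =
      Matrix.fromBlocks 1 (Matrix.of fun s t => g.repr (w (σ t)) (Sum.inl s)) 0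
        ((subBasis F e T).toMatrix
          ((fun k => Submodule.projectionOnto _ _ h.symm (w k)) ∘ σ)) := by
    ext (a | a) (b | b)
    · simp [Basis.toMatrix_apply, Matrix.one_apply, Finsupp.single_apply, eq_comm]
    · simp [Basis.toMatrix_apply]
    · simp [Basis.toMatrix_apply]
    · simp [Basis.toMatrix_apply, g]
  rw [hM, Matrix.det_fromBlocks_zero₂₁, Matrix.det_one, one_mul]

end Determinants

section ChainComplex

variable {F} {C : ℕ → Type} [∀ i, AddCommGroup (C i)] [∀ i, Module F (C i)]
  {d : ∀ i, C (i + 1) →ₗ[F] C i} {ι : ℕ → Type} {e : ∀ i, Basis (ι i) F (C i)}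
  {S T : ∀ i, Finset (ι i)}

lemma projBoundary_apply
    (hcompl : ∀ i, IsCompl (span F (⇑(e i) '' ↑(S i))) (span F (⇑(e i) '' ↑(T i)))) (i : ℕ)
    (x : span F (⇑(e (i + 1)) '' ↑(S (i + 1)))) :
    projBoundary F C d e S T hcompl i x =
      Submodule.projectionOnto _ _ (hcompl i).symm (d i x) :=
  rfl

/-- Any vector of `C_i` is a combination of the basis vectors spanning `A_i`, modulo boundaries. -/
lemma exists_sub_sum_mem_range (hacyc : ∀ i, bdry F C d i = cyc F C d i)
    (b : ∀ i, Basis {j // j ∈ S (i + 1)} F (LinearMap.range (d i)))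
    (hb : ∀ i j, (b i j : C i) = d i (e (i + 1) j)) (i : ℕ) (x : C i) :
    ∃ c : {j // j ∈ S i} → F, x - ∑ j, c j • e i j ∈ LinearMap.range (d i) := by
  have h := hacyc i
  rw [bdry] at h
  rw [h]
  cases i with
  | zero => exact ⟨0, trivial⟩
  | succ i =>
    refine ⟨(b i).repr ⟨d i x, x, rfl⟩, ?_⟩
    have := congrArg Subtype.val ((b i).sum_repr ⟨d i x, x, rfl⟩)
    simp only [AddSubmonoidClass.coe_finsetSum, SetLike.val_smul, hb] at this
    rw [cyc, LinearMap.mem_ker, map_sub, map_sum, sub_eq_zero]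
    simpa only [map_smul] using this.symm

/-- A decomposition as in `altProd` splits the boundary map: the images of the basis vectors
spanning `A_{i+1}` form a basis of the boundaries in degree `i`. -/
lemma exists_basis_range (hd : ∀ i, (d i).comp (d (i + 1)) = 0)
    (hcompl : ∀ i, IsCompl (span F (⇑(e i) '' ↑(S i))) (span F (⇑(e i) '' ↑(T i))))
    (hS0 : span F (⇑(e 0) '' ↑(S 0)) = ⊥)
    (hbij : ∀ i, Function.Bijective (projBoundary F C d e S T hcompl i)) (i : ℕ) :
    ∃ b : Basis {j // j ∈ S (i + 1)} F (LinearMap.range (d i)),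
      ∀ j, (b j : C i) = d i (e (i + 1) j) := by
  have hinj : ∀ i, ∀ x ∈ span F (⇑(e (i + 1)) '' ↑(S (i + 1))), d i x = 0 → x = 0 := by
    intro i x hx h0
    have : (⟨x, hx⟩ : span F (⇑(e (i + 1)) '' ↑(S (i + 1)))) = 0 :=
      (hbij i).1 (by simp [projBoundary_apply, h0])
    simpa using this
  have hdisj : ∀ x ∈ span F (⇑(e i) '' ↑(S i)), x ∈ LinearMap.range (d i) → x = 0 := by
    cases i with
    | zero =>
      intro x hx _
      simpa [hS0] using hx
    | succ i =>
      rintro x hx ⟨y, rfl⟩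
      exact hinj i _ hx (LinearMap.congr_fun (hd i) y)
  let f := (d i).rangeRestrict.comp (span F (⇑(e (i + 1)) '' ↑(S (i + 1)))).subtype
  have hf : Function.Bijective f := by
    constructor
    · rw [injective_iff_map_eq_zero]
      intro x hx
      exact Subtype.ext (hinj i x x.2 (congrArg Subtype.val hx))
    · rintro ⟨x, hx⟩
      obtain ⟨a, ha⟩ := (hbij i).2 (Submodule.projectionOnto _ _ (hcompl i).symm x)
      refine ⟨a, Subtype.ext ?_⟩
      have h0 : Submodule.projectionOnto _ _ (hcompl i).symm (x - d i a) = 0 := by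
        rw [map_sub, ← ha]
        simp [projBoundary_apply]
      rw [Submodule.projectionOnto_apply_eq_zero_iff] at h0
      have := hdisj _ h0 (sub_mem hx ⟨a, rfl⟩)
      exact (sub_eq_zero.1 this).symm
  refine ⟨(subBasis F (e (i + 1)) (S (i + 1))).map (LinearEquiv.ofBijective f hf), fun j => ?_⟩
  simp [f, subBasis_apply]

variable [∀ i, Fintype (ι i)]

/-- Each factor of `altProd` is, up to sign, the determinant of a full basis of `C_i`. -/
lemma detMap_projBoundary_sq
    (hcompl : ∀ i, IsCompl (span F (⇑(e i) '' ↑(S i))) (span F (⇑(e i) '' ↑(T i))))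
    (hbij : ∀ i, Function.Bijective (projBoundary F C d e S T hcompl i)) (i : ℕ) :
    detMap F (subBasis F (e (i + 1)) (S (i + 1))) (subBasis F (e i) (T i))
        (projBoundary F C d e S T hcompl i) ^ 2 =
      detFam F (e i) (Sum.elim (fun j : {j // j ∈ S i} => e i j)
        (fun j : {j // j ∈ S (i + 1)} => d i (e (i + 1) j))) ^ 2 := by
  rw [detFam_sumElim_sq (e i) (S i) (T i) (hcompl i) _
    ((subBasis F (e i) (T i)).indexEquiv ((subBasis F (e (i + 1)) (S (i + 1))).map
      (LinearEquiv.ofBijective _ (hbij i)))), detMap]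
  simp [projBoundary_apply, subBasis_apply]

end ChainComplex

/-- Telescoping of an alternating product. -/
lemma prod_range_zpow_alternating {K : Type*} [Field K] (p : ℕ → K) (hp : ∀ i, p i ≠ 0) (m : ℕ) :
    ∏ i ∈ Finset.range m, (p i * p (i + 1)) ^ ((-1 : ℤ) ^ (i + 1)) =
      (p 0)⁻¹ * p m ^ ((-1 : ℤ) ^ m) := by
  induction m with
  | zero => simp [hp 0]
  | succ m ih =>
    rw [Finset.prod_range_succ, ih, mul_zpow, pow_succ, mul_neg_one, zpow_neg, zpow_neg]
    have := zpow_ne_zero ((-1 : ℤ) ^ m) (hp m)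
    field_simp

/-- Let `(C_*, ∂)` be a finite acyclic chain complex of finite-dimensional `F`-vector spaces,
concentrated in degrees `0, …, n`, with ordered basis `e`.  Suppose `C_i = A_i ⊕ B_i` and
`C_i = A'_i ⊕ B'_i` are two decompositions into spans of subsets of the basis `e_i` (indexed by
`S_i, T_i` resp. `S'_i, T'_i`) such that `π_{B_{i-1}} ∘ ∂|_{A_i}` and `π_{B'_{i-1}} ∘ ∂|_{A'_i}`
are isomorphisms for every `i` (for `i = 0` this means `A_0 = A'_0 = 0`).  Then the two
alternating products `Π_i det(π_{B_{i-1}} ∘ ∂|_{A_i})^{(-1)^i}` agree up to sign. -/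
theorem altProd_eq_up_to_sign
    (C : ℕ → Type) [∀ i, AddCommGroup (C i)] [∀ i, Module F (C i)]
    [∀ i, FiniteDimensional F (C i)]
    (d : ∀ i, C (i + 1) →ₗ[F] C i)
    (hd : ∀ i, (d i).comp (d (i + 1)) = 0)
    (n : ℕ) (htriv : ∀ i, n < i → Subsingleton (C i))
    (ι : ℕ → Type) [∀ i, Fintype (ι i)] (e : ∀ i, Basis (ι i) F (C i))
    (hacyc : ∀ i, bdry F C d i = cyc F C d i)
    (S T S' T' : ∀ i, Finset (ι i))
    (hcompl : ∀ i, IsCompl (span F (⇑(e i) '' ↑(S i))) (span F (⇑(e i) '' ↑(T i))))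
    (hcompl' : ∀ i, IsCompl (span F (⇑(e i) '' ↑(S' i))) (span F (⇑(e i) '' ↑(T' i))))
    (hS0 : span F (⇑(e 0) '' ↑(S 0)) = ⊥)
    (hS0' : span F (⇑(e 0) '' ↑(S' 0)) = ⊥)
    (hbij : ∀ i, Function.Bijective (projBoundary F C d e S T hcompl i))
    (hbij' : ∀ i, Function.Bijective (projBoundary F C d e S' T' hcompl' i)) :
    altProd F C d e S T hcompl n = altProd F C d e S' T' hcompl' n ∨
      altProd F C d e S T hcompl n = -altProd F C d e S' T' hcompl' n := by
  classical
  choose b hb using exists_basis_range hd hcompl hS0 hbij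
  choose b' hb' using exists_basis_range hd hcompl' hS0' hbij'
  have hempty : ∀ i (U : Finset (ι i)), span F (⇑(e i) '' ↑U) = ⊥ → IsEmpty {j // j ∈ U} :=
    fun i U h => ⟨fun j => (e i).ne_zero j ((Submodule.eq_bot_iff _).1 h _
      (subset_span ⟨j, j.2, rfl⟩))⟩
  have := hempty 0 _ hS0
  have := hempty 0 _ hS0'
  have hσ : ∀ i, Nonempty ({j // j ∈ S i} ≃ {j // j ∈ S' i}) := by
    rintro (_ | i)
    · exact ⟨Equiv.equivOfIsEmpty _ _⟩
    · exact ⟨(b i).indexEquiv (b' i)⟩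
  let σ i := Classical.choice (hσ i)
  choose P hP using fun i (k : {j // j ∈ S i}) =>
    exists_sub_sum_mem_range hacyc b hb i (e i (σ i k))
  let D i := detMap F (subBasis F (e (i + 1)) (S (i + 1))) (subBasis F (e i) (T i))
    (projBoundary F C d e S T hcompl i)
  let D' i := detMap F (subBasis F (e (i + 1)) (S' (i + 1))) (subBasis F (e i) (T' i))
    (projBoundary F C d e S' T' hcompl' i)
  let p i := (Matrix.of fun j k => P i k j).det ^ 2
  have hD' : ∀ i, D' i ≠ 0 := fun i => detMap_ne_zero _ _ _ (hbij' i)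
  have hstep : ∀ i, D' i ^ 2 = D i ^ 2 * (p i * p (i + 1)) := by
    intro i
    have hrel : ∀ k, d i (e (i + 1) (σ (i + 1) k)) =
        ∑ j, P (i + 1) k j • d i (e (i + 1) j) := by
      intro k
      obtain ⟨y, hy⟩ := hP (i + 1) k
      have h0 := LinearMap.congr_fun (hd i) y
      rw [LinearMap.comp_apply, hy, LinearMap.zero_apply, map_sub, sub_eq_zero] at h0
      simpa using h0
    let Q k := (b i).repr ⟨_, hP i k⟩
    have hQ : ∀ k, e i (σ i k) =
        ∑ j, P i k j • e i j + ∑ j, Q k j • d i (e (i + 1) j) := by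
      intro k
      have := congrArg Subtype.val ((b i).sum_repr ⟨_, hP i k⟩)
      simp only [AddSubmonoidClass.coe_finsetSum, SetLike.val_smul, hb] at this
      rw [this]
      abel
    have h1 : D' i ^ 2 = _ := detMap_projBoundary_sq hcompl' hbij' i
    have h2 : D i ^ 2 = _ := detMap_projBoundary_sq hcompl hbij i
    rw [h1, h2, ← detFam_comp_equiv_sq _ _ (Equiv.sumCongr (σ i) (σ (i + 1))),
      detFam_sum_smul_sq (e i) _ _ (Matrix.fromBlocks (Matrix.of fun j k => P i k j) 0
        (Matrix.of fun j k => Q k j) (Matrix.of fun j k => P (i + 1) k j)),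
      Matrix.det_fromBlocks_zero₁₂, mul_pow]
    rintro (k | k)
    · simpa using hQ k
    · simpa using hrel k
  have hp : ∀ i, p i ≠ 0 := fun i h => hD' i (by simpa [h] using hstep i)
  have hp0 : p 0 = 1 := by simp [p]
  have hpn : p (n + 1) = 1 := by
    have := htriv (n + 1) n.lt_succ_self
    have := hempty (n + 1) (S (n + 1)) (Subsingleton.elim _ _)
    simp [p]
  refine sq_eq_sq_iff_eq_or_eq_neg.1 (Eq.symm ?_)
  change (∏ i ∈ Finset.range (n + 1), D' i ^ ((-1 : ℤ) ^ (i + 1))) ^ 2 =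
    (∏ i ∈ Finset.range (n + 1), D i ^ ((-1 : ℤ) ^ (i + 1))) ^ 2
  have hsq : ∀ (x : F) (k : ℤ), (x ^ k) ^ 2 = (x ^ 2) ^ k := fun x k => by
    rw [← zpow_natCast, ← zpow_natCast, zpow_comm]
  simp_rw [← Finset.prod_pow, hsq, hstep, mul_zpow (D _ ^ 2), Finset.prod_mul_distrib,
    prod_range_zpow_alternating p hp, hp0, hpn]
  simp

end
end

section
/- Let F be a field and let 0 → C_* → C'_* → C''_* → 0 be a short exact sequence of finite chain complexes of finite-dimensional F-vector spaces. Let e, e', e'' be ordered bases for C_*, C'_*, C''_* compatible with the exact sequence (i.e. e'_i consists of the image of e_i together with a lift of e''_i). Let h, h', h'' be ordered bases for the homology H_*(C), H_*(C'), H_*(C''). Let L_* denote the long exact homology sequence of the short exact sequence, regarded as a finite acyclic chain complex, with basis b obtained by combining h, h', h''. Then the Reidemeister torsions satisfy τ̂(C', e', h') = ± τ̂(C, e, h) · τ̂(C'', e'', h'') · τ(L_*, b). -/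
open Module Submodule

noncomputable section

variable (F : Type) [Field F]

section Torsion

variable (C : ℕ → Type) [∀ i, AddCommGroup (C i)] [∀ i, Module F (C i)]
  [∀ i, FiniteDimensional F (C i)] (d : ∀ i, C (i + 1) →ₗ[F] C i)

/-- The homology `H_i = Z_i / B_i` of the chain complex `(C_*, ∂)`. -/
abbrev hml (i : ℕ) : Type :=
  ↥(cyc F C d i) ⧸ Submodule.comap (cyc F C d i).subtype (bdry F C d i)

/-- A chosen linear right inverse of `∂ : C_{i+1} → B_i`. -/
def secB (i : ℕ) : ↥(bdry F C d i) →ₗ[F] C (i + 1) :=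
  ((d i).rangeRestrict.exists_rightInverse_of_surjective
    (LinearMap.range_eq_top.mpr (d i).surjective_rangeRestrict)).choose

/-- A chosen linear right inverse of the projection `Z_i → H_i`. -/
def secH (i : ℕ) : hml F C d i →ₗ[F] ↥(cyc F C d i) :=
  ((Submodule.comap (cyc F C d i).subtype (bdry F C d i)).mkQ.exists_rightInverse_of_surjective
    (Submodule.range_mkQ _)).choose

/-- The dimension of `B_{i-1}` (zero for `i = 0`). -/
def prevRank : ℕ → ℕ
  | 0 => 0
  | (i + 1) => finrank F ↥(bdry F C d i)

/-- A chosen lift to `C_i` of a basis of `B_{i-1}` (empty for `i = 0`). -/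
def thirdFam : ∀ i : ℕ, Fin (prevRank F C d i) → C i
  | 0 => fun j => j.elim0
  | (i + 1) => fun j => secB F C d i (Module.finBasis F ↥(bdry F C d i) j)

/-- The family of vectors in `C_i` consisting of a basis of `B_i`, a lift of the given basis of
`H_i`, and a lift of a basis of `B_{i-1}`.  This is a new basis of `C_i`; comparing it with the
given basis `e_i` computes the Reidemeister torsion à la Milnor. -/
def torFam {κ : ℕ → Type} (h : ∀ i, Basis (κ i) F (hml F C d i)) (i : ℕ) :
    Fin (finrank F ↥(bdry F C d i)) ⊕ κ i ⊕ Fin (prevRank F C d i) → C i :=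
  fun x => match x with
  | Sum.inl j => ((Module.finBasis F ↥(bdry F C d i) j : ↥(bdry F C d i)) : C i)
  | Sum.inr (Sum.inl k) => ((secH F C d i (h i k) : ↥(cyc F C d i)) : C i)
  | Sum.inr (Sum.inr j) => thirdFam F C d i j

/-- The Reidemeister torsion `τ̂(C_*, e, h) = Φ([e])/[h]` of the chain complex `(C_*, ∂)`
concentrated in degrees `0, …, n`, with respect to the basis `e` of `C_*` and the basis `h` of
the homology `H_*`, computed à la Milnor from a choice of auxiliary bases and sections (the
result is independent of these choices up to sign). -/
def torsionHat (n : ℕ) {ι κ : ℕ → Type} [∀ i, Fintype (ι i)] [∀ i, Fintype (κ i)]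
    (e : ∀ i, Basis (ι i) F (C i)) (h : ∀ i, Basis (κ i) F (hml F C d i)) : F :=
  ∏ i ∈ Finset.range (n + 1),
    (detFam F (e i) (torFam F C d h i)) ^ ((-1 : ℤ) ^ (i + 1))

open scoped Classical in
/-- The Reidemeister torsion `τ(C_*, e)`: it is `τ̂(C_*, e, 1)` if the complex is acyclic, and
`0` otherwise. -/
def torsion (n : ℕ) {ι : ℕ → Type} [∀ i, Fintype (ι i)] (e : ∀ i, Basis (ι i) F (C i)) : F :=
  if ∀ i, bdry F C d i = cyc F C d i then
    torsionHat F C d n e fun i => Module.finBasis F (hml F C d i)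
  else 0

end Torsion
/-- The underlying spaces of the long exact homology sequence, regarded as a chain complex:
`L_{3i} = A_i`, `L_{3i+1} = B_i`, `L_{3i+2} = C_i`. -/
def L3 : (ℕ → Type) → (ℕ → Type) → (ℕ → Type) → ℕ → Type
  | A, _, _, 0 => A 0
  | _, B, _, 1 => B 0
  | _, _, C, 2 => C 0
  | A, B, C, (j + 3) =>
      L3 (fun i => A (i + 1)) (fun i => B (i + 1)) (fun i => C (i + 1)) j

instance instL3acg : ∀ (A B C : ℕ → Type), [∀ i, AddCommGroup (A i)] → [∀ i, AddCommGroup (B i)] →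
    [∀ i, AddCommGroup (C i)] → ∀ j, AddCommGroup (L3 A B C j)
  | A, _, _, _, _, _, 0 => inferInstanceAs (AddCommGroup (A 0))
  | _, B, _, _, _, _, 1 => inferInstanceAs (AddCommGroup (B 0))
  | _, _, C, _, _, _, 2 => inferInstanceAs (AddCommGroup (C 0))
  | A, B, C, _, _, _, (j + 3) =>
      instL3acg (fun i => A (i + 1)) (fun i => B (i + 1)) (fun i => C (i + 1)) j

instance instL3mod : ∀ (A B C : ℕ → Type), [∀ i, AddCommGroup (A i)] → [∀ i, AddCommGroup (B i)] →
    [∀ i, AddCommGroup (C i)] → [∀ i, Module F (A i)] → [∀ i, Module F (B i)] →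
    [∀ i, Module F (C i)] → ∀ j, Module F (L3 A B C j)
  | A, _, _, _, _, _, _, _, _, 0 => inferInstanceAs (Module F (A 0))
  | _, B, _, _, _, _, _, _, _, 1 => inferInstanceAs (Module F (B 0))
  | _, _, C, _, _, _, _, _, _, 2 => inferInstanceAs (Module F (C 0))
  | A, B, C, _, _, _, _, _, _, (j + 3) =>
      instL3mod (fun i => A (i + 1)) (fun i => B (i + 1)) (fun i => C (i + 1)) j

instance instL3fd : ∀ (A B C : ℕ → Type), [∀ i, AddCommGroup (A i)] → [∀ i, AddCommGroup (B i)] →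
    [∀ i, AddCommGroup (C i)] → [∀ i, Module F (A i)] → [∀ i, Module F (B i)] →
    [∀ i, Module F (C i)] → [∀ i, FiniteDimensional F (A i)] → [∀ i, FiniteDimensional F (B i)] →
    [∀ i, FiniteDimensional F (C i)] → ∀ j, FiniteDimensional F (L3 A B C j)
  | A, _, _, _, _, _, _, _, _, _, _, _, 0 => inferInstanceAs (FiniteDimensional F (A 0))
  | _, B, _, _, _, _, _, _, _, _, _, _, 1 => inferInstanceAs (FiniteDimensional F (B 0))
  | _, _, C, _, _, _, _, _, _, _, _, _, 2 => inferInstanceAs (FiniteDimensional F (C 0))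
  | A, B, C, _, _, _, _, _, _, _, _, _, (j + 3) =>
      instL3fd (fun i => A (i + 1)) (fun i => B (i + 1)) (fun i => C (i + 1)) j

instance instL3fin : ∀ (A B C : ℕ → Type), [∀ i, Fintype (A i)] → [∀ i, Fintype (B i)] →
    [∀ i, Fintype (C i)] → ∀ j, Fintype (L3 A B C j)
  | A, _, _, _, _, _, 0 => inferInstanceAs (Fintype (A 0))
  | _, B, _, _, _, _, 1 => inferInstanceAs (Fintype (B 0))
  | _, _, C, _, _, _, 2 => inferInstanceAs (Fintype (C 0))
  | A, B, C, _, _, _, (j + 3) =>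
      instL3fin (fun i => A (i + 1)) (fun i => B (i + 1)) (fun i => C (i + 1)) j

/-- The differentials of the long exact homology sequence, regarded as a chain complex:
`a_i : L_{3i+1} → L_{3i}`, `b_i : L_{3i+2} → L_{3i+1}`, `c_i : L_{3i+3} → L_{3i+2}`. -/
def dL3 : ∀ (A B C : ℕ → Type), [∀ i, AddCommGroup (A i)] → [∀ i, AddCommGroup (B i)] →
    [∀ i, AddCommGroup (C i)] → [∀ i, Module F (A i)] → [∀ i, Module F (B i)] →
    [∀ i, Module F (C i)] →
    (∀ i, B i →ₗ[F] A i) → (∀ i, C i →ₗ[F] B i) → (∀ i, A (i + 1) →ₗ[F] C i) →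
    ∀ j, L3 A B C (j + 1) →ₗ[F] L3 A B C j
  | _, _, _, _, _, _, _, _, _, a, _, _, 0 => a 0
  | _, _, _, _, _, _, _, _, _, _, b, _, 1 => b 0
  | _, _, _, _, _, _, _, _, _, _, _, c, 2 => c 0
  | A, B, C, _, _, _, _, _, _, a, b, c, (j + 3) =>
      dL3 (fun i => A (i + 1)) (fun i => B (i + 1)) (fun i => C (i + 1))
        (fun i => a (i + 1)) (fun i => b (i + 1)) (fun i => c (i + 1)) j

/-- The basis of the long exact homology sequence obtained by combining the bases of its
terms. -/
def L3basis : ∀ (A B C : ℕ → Type), [∀ i, AddCommGroup (A i)] → [∀ i, AddCommGroup (B i)] →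
    [∀ i, AddCommGroup (C i)] → [∀ i, Module F (A i)] → [∀ i, Module F (B i)] →
    [∀ i, Module F (C i)] → ∀ (κA κB κC : ℕ → Type),
    (∀ i, Basis (κA i) F (A i)) → (∀ i, Basis (κB i) F (B i)) → (∀ i, Basis (κC i) F (C i)) →
    ∀ j, Basis (L3 κA κB κC j) F (L3 A B C j)
  | _, _, _, _, _, _, _, _, _, _, _, _, bA, _, _, 0 => bA 0
  | _, _, _, _, _, _, _, _, _, _, _, _, _, bB, _, 1 => bB 0
  | _, _, _, _, _, _, _, _, _, _, _, _, _, _, bC, 2 => bC 0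
  | A, B, C, _, _, _, _, _, _, κA, κB, κC, bA, bB, bC, (j + 3) =>
      L3basis (fun i => A (i + 1)) (fun i => B (i + 1)) (fun i => C (i + 1))
        (fun i => κA (i + 1)) (fun i => κB (i + 1)) (fun i => κC (i + 1))
        (fun i => bA (i + 1)) (fun i => bB (i + 1)) (fun i => bC (i + 1)) j

section DetSq

variable {M ι κ : Type} [AddCommGroup M] [Module F M] [Fintype ι] [Fintype κ]

/-- The square of `detFam`, which does not depend on the identification of the index types. -/
def detSq (e : Basis ι F M) (v : κ → M) : F := detFam F e v ^ 2

variable {F}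

lemma detSq_eq [DecidableEq ι] (e : Basis ι F M) (v : κ → M) (σ : κ ≃ ι) :
    detSq F e v = e.det (v ∘ σ.symm) ^ 2 := by
  have hc : Nonempty (κ ≃ ι) := ⟨σ⟩
  rw [detSq, detFam, dif_pos hc]
  set σ₀ := Classical.choice hc
  have hv : v ∘ σ₀.symm = (v ∘ σ.symm) ∘ (σ₀.symm.trans σ) := by
    ext i; simp
  rw [hv, AlternatingMap.map_perm]
  rcases Int.units_eq_one_or (Equiv.Perm.sign (σ₀.symm.trans σ)) with hs | hs <;>
    rw [hs] <;> simp <;> congr! 3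

lemma detSq_eq_zero_of_isEmpty (e : Basis ι F M) (v : κ → M) (hc : IsEmpty (κ ≃ ι)) :
    detSq F e v = 0 := by
  rw [detSq, detFam, dif_neg (not_nonempty_iff.mpr hc)]
  simp

lemma nonempty_equiv_of_detSq_ne_zero {e : Basis ι F M} {v : κ → M} (hv : detSq F e v ≠ 0) :
    Nonempty (κ ≃ ι) := by
  by_contra hc
  exact hv (detSq_eq_zero_of_isEmpty e v (not_nonempty_iff.mp hc))

lemma detSq_comp_equiv {κ₁ : Type} [Fintype κ₁] (e : Basis ι F M) (v : κ → M) (σ : κ₁ ≃ κ) :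
    detSq F e (v ∘ σ) = detSq F e v := by
  classical
  by_cases hc : Nonempty (κ ≃ ι)
  · obtain ⟨τ⟩ := hc
    rw [detSq_eq e v τ, detSq_eq e (v ∘ σ) (σ.trans τ)]
    congr 2
    ext i
    simp
  · rw [detSq_eq_zero_of_isEmpty e v (not_nonempty_iff.mp hc), detSq_eq_zero_of_isEmpty]
    exact ⟨fun τ => hc ⟨σ.symm.trans τ⟩⟩

lemma detSq_self (e : Basis ι F M) : detSq F e e = 1 := by
  classical
  rw [detSq_eq e e (Equiv.refl ι)]
  simp [e.det_self]

lemma detSq_basis_ne_zero (e : Basis ι F M) (b : Basis κ F M) : detSq F e b ≠ 0 := by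
  classical
  have σ : κ ≃ ι := b.indexEquiv e
  rw [detSq_eq e b σ]
  have := (e.isUnit_det (b.reindex σ)).ne_zero
  rw [Basis.coe_reindex] at this
  exact pow_ne_zero 2 this

lemma detSq_trans {β : Type} [Fintype β] (e : Basis ι F M) (b : Basis β F M) (v : κ → M) :
    detSq F e v = detSq F e b * detSq F b v := by
  classical
  have σ : β ≃ ι := b.indexEquiv e
  by_cases hc : Nonempty (κ ≃ β)
  · obtain ⟨τ⟩ := hc
    have h1 : detSq F b v = detSq F (b.reindex σ) v := by
      rw [detSq_eq b v τ, detSq_eq (b.reindex σ) v (τ.trans σ), Basis.det_reindex]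
      congr 2
      ext i
      simp
    rw [h1, detSq_eq e v (τ.trans σ), detSq_eq e b σ, detSq_eq _ v (τ.trans σ), ← mul_pow]
    congr 1
    rw [← Basis.coe_reindex, Basis.det_apply, Basis.det_apply, Basis.det_apply, ← Matrix.det_mul,
      Basis.toMatrix_mul_toMatrix]
  · rw [detSq_eq_zero_of_isEmpty b v (not_nonempty_iff.mp hc), mul_zero,
      detSq_eq_zero_of_isEmpty]
    exact ⟨fun τ => hc ⟨τ.trans σ.symm⟩⟩

lemma detSq_eq_one_of_subsingleton [Subsingleton M] {e : Basis ι F M} {v : κ → M}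
    (hc : Nonempty (κ ≃ ι)) : detSq F e v = 1 := by
  classical
  obtain ⟨σ⟩ := hc
  have : v ∘ σ.symm = e := Subsingleton.elim _ _
  rw [detSq_eq e v σ, this, e.det_self, one_pow]

/-- Multiplicativity of determinants in a short exact sequence of vector spaces. -/
lemma detSq_sumElim {A Q α γ ξ η : Type} [AddCommGroup A] [Module F A] [AddCommGroup Q]
    [Module F Q] [Fintype α] [Fintype γ] [Fintype ξ] [Fintype η]
    {f : A →ₗ[F] M} {g : M →ₗ[F] Q} (hfg : ∀ x, g (f x) = 0)
    (a : Basis α F A) (q : Basis γ F Q) (b : Basis (α ⊕ γ) F M)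
    (hbf : ∀ j, b (Sum.inl j) = f (a j)) (hbg : ∀ j, g (b (Sum.inr j)) = q j)
    (x : ξ → A) (y : η → M) (hc : Nonempty (η ≃ γ)) :
    detSq F b (Sum.elim (fun j => f (x j)) y) = detSq F a x * detSq F q (fun j => g (y j)) := by
  classical
  obtain ⟨τ⟩ := hc
  by_cases hc : Nonempty (ξ ≃ α)
  · obtain ⟨σ⟩ := hc
    rw [detSq_eq _ _ (Equiv.sumCongr σ τ), detSq_eq _ _ σ, detSq_eq _ _ τ, ← mul_pow]
    congr 1
    have hl : ∀ (z : A), b.repr (f z) = (a.repr z).mapDomain Sum.inl := by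
      intro z
      have : f z = Finsupp.linearCombination F b ((a.repr z).mapDomain Sum.inl) := by
        rw [Finsupp.linearCombination_mapDomain]
        conv_lhs => rw [← a.linearCombination_repr z]
        rw [Finsupp.apply_linearCombination]
        congr 2
        ext j
        simp [hbf]
      rw [this, b.repr_linearCombination]
    have hr : ∀ (z : M) (j : γ), q.repr (g z) j = b.repr z (Sum.inr j) := by
      intro z j
      have : (Finsupp.lapply (Sum.inr j)).comp b.repr.toLinearMap =
          (Finsupp.lapply j).comp (q.repr.toLinearMap.comp g) := by
        refine b.ext ?_
        rintro (i | i)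
        · simp [hbf, hfg, hl]
        · simp [hbg, Finsupp.single_apply]
      exact (LinearMap.congr_fun this z).symm
    have hm : b.toMatrix (Sum.elim (fun j => f (x j)) y ∘ (Equiv.sumCongr σ τ).symm) =
        Matrix.fromBlocks (a.toMatrix (x ∘ σ.symm))
          (Matrix.of fun i j => b.repr (y (τ.symm j)) (Sum.inl i)) 0
          (q.toMatrix ((fun j => g (y j)) ∘ τ.symm)) := by
      ext i j
      rcases i with i | i <;> rcases j with j | j
      · simp [Basis.toMatrix_apply, hl, Finsupp.mapDomain_apply Sum.inl_injective]
      · simp [Basis.toMatrix_apply]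
      · simp [Basis.toMatrix_apply, hl, Finsupp.mapDomain_of_notMem_range]
      · simp [Basis.toMatrix_apply, hr]
    rw [Basis.det_apply, hm, Matrix.det_fromBlocks_zero₂₁, Basis.det_apply, Basis.det_apply]
  · rw [detSq_eq_zero_of_isEmpty a x (not_nonempty_iff.mp hc), zero_mul]
    refine detSq_eq_zero_of_isEmpty _ _ ⟨fun ρ => hc ?_⟩
    have h1 := Fintype.card_congr ρ
    have h2 := Fintype.card_congr τ
    rw [Fintype.card_sum, Fintype.card_sum] at h1
    exact Fintype.card_eq.mp (by omega)

/-- A basis of the middle term of a short exact sequence of vector spaces, built from a basis of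
the submodule and a lift of a basis of the quotient. -/
lemma exists_basis_sum {A Q α γ : Type} [AddCommGroup A] [Module F A] [AddCommGroup Q]
    [Module F Q] {f : A →ₗ[F] M} {g : M →ₗ[F] Q} (hf : Function.Injective f)
    (hfg : LinearMap.range f = LinearMap.ker g) (a : Basis α F A) (q : Basis γ F Q)
    (y : γ → M) (hy : ∀ j, g (y j) = q j) :
    ∃ b : Basis (α ⊕ γ) F M, (∀ j, b (Sum.inl j) = f (a j)) ∧ ∀ j, b (Sum.inr j) = y j := by
  have hgf : ∀ x, g (f x) = 0 := fun x => by
    rw [← LinearMap.mem_ker, ← hfg]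
    exact ⟨x, rfl⟩
  let s : Q →ₗ[F] M := q.constr F y
  have hs : ∀ j, s (q j) = y j := fun j => q.constr_basis F y j
  have hgs : ∀ z, g (s z) = z := fun z => by
    have : g.comp s = LinearMap.id := q.ext fun j => by simp [hs, hy]
    exact LinearMap.congr_fun this z
  have hbij : Function.Bijective (f.coprod s) := by
    constructor
    · rw [← LinearMap.ker_eq_bot, LinearMap.ker_eq_bot']
      rintro ⟨x, z⟩ hxz
      rw [LinearMap.coprod_apply] at hxz
      have hz : z = 0 := by simpa [hgf, hgs] using congrArg g hxz
      rw [hz, map_zero, add_zero] at hxz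
      change f x = 0 at hxz
      rw [hz, (map_eq_zero_iff f hf).mp hxz]
      rfl
    · intro m
      have hm : m - s (g m) ∈ LinearMap.range f := by
        rw [hfg, LinearMap.mem_ker, map_sub, hgs, sub_self]
      obtain ⟨x, hx⟩ := hm
      exact ⟨(x, g m), by simp [hx]⟩
  refine ⟨(a.prod q).map (LinearEquiv.ofBijective _ hbij), fun j => ?_, fun j => ?_⟩
  · simp
  · simp [hs]

end DetSq

section TorFam

variable {F} {C : ℕ → Type} [∀ i, AddCommGroup (C i)] [∀ i, Module F (C i)]
  {d : ∀ i, C (i + 1) →ₗ[F] C i}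

lemma bdry_le_cyc (hd : ∀ i, (d i).comp (d (i + 1)) = 0) : ∀ i, bdry F C d i ≤ cyc F C d i
  | 0 => le_top
  | i + 1 => by
    rintro _ ⟨x, rfl⟩
    exact LinearMap.congr_fun (hd i) x

variable [∀ i, FiniteDimensional F (C i)]

lemma mk_secH (i : ℕ) (x : hml F C d i) :
    (Submodule.Quotient.mk (secH F C d i x) : hml F C d i) = x :=
  LinearMap.congr_fun ((Submodule.comap (cyc F C d i).subtype
    (bdry F C d i)).mkQ.exists_rightInverse_of_surjective (Submodule.range_mkQ _)).choose_spec x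

lemma d_secB (i : ℕ) (x : bdry F C d i) : d i (secB F C d i x) = x :=
  congrArg Subtype.val (LinearMap.congr_fun
    ((d i).rangeRestrict.exists_rightInverse_of_surjective
      (LinearMap.range_eq_top.mpr (d i).surjective_rangeRestrict)).choose_spec x)

/-- The change of the family `c` of lifts of a basis of `B_{i-1}`, measured by its image in
`B_{i-1}`. -/
def prevDet (d : ∀ i, C (i + 1) →ₗ[F] C i) {ρ : Type} [Fintype ρ] : ∀ i, (ρ → C i) → F
  | 0, _ => 1
  | i + 1, c => detSq F (Module.finBasis F (bdry F C d i)) fun j => (d i).rangeRestrict (c j)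

lemma prevDet_thirdFam (i : ℕ) : prevDet d i (thirdFam F C d i) = 1 := by
  cases i with
  | zero => rfl
  | succ i =>
    have : (fun j => (d i).rangeRestrict (thirdFam F C d (i + 1) j)) =
        Module.finBasis F (bdry F C d i) := by
      funext j
      exact Subtype.ext (d_secB i _)
    simp only [prevDet]
    rw [this]
    exact detSq_self _

variable {κ : ℕ → Type} [∀ i, Fintype (κ i)]

lemma exists_basis_torFam_of_surjective (hd : ∀ i, (d i).comp (d (i + 1)) = 0)
    (h : ∀ i, Basis (κ i) F (hml F C d i)) (i : ℕ)
    {Q : Type} [AddCommGroup Q] [Module F Q] (π : C i →ₗ[F] Q)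
    (hπ : cyc F C d i = LinearMap.ker π) (q : Basis (Fin (prevRank F C d i)) F Q)
    (hq : ∀ j, π (thirdFam F C d i j) = q j) :
    ∃ T : Basis (Fin (finrank F (bdry F C d i)) ⊕ κ i ⊕ Fin (prevRank F C d i)) F (C i),
      ⇑T = torFam F C d h i ∧
      ∀ {σ τ ρ : Type} [Fintype σ] [Fintype τ] [Fintype ρ] (b : σ → bdry F C d i)
        (z : τ → cyc F C d i) (c : ρ → C i), Nonempty (τ ≃ κ i) →
        Nonempty (ρ ≃ Fin (prevRank F C d i)) →
        detSq F T (Sum.elim (fun j => (b j : C i)) (Sum.elim (fun j => (z j : C i)) c)) =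
          detSq F (Module.finBasis F (bdry F C d i)) b *
            detSq F (h i) (fun j => (Submodule.Quotient.mk (z j) : hml F C d i)) *
            detSq F q (fun j => π (c j)) := by
  have hle := bdry_le_cyc hd i
  let P := Submodule.comap (cyc F C d i).subtype (bdry F C d i)
  have hBZ : LinearMap.range (Submodule.inclusion hle) = LinearMap.ker P.mkQ := by
    rw [Submodule.ker_mkQ, Submodule.range_inclusion]
  obtain ⟨S, hS₁, hS₂⟩ := exists_basis_sum (Submodule.inclusion_injective hle) hBZ
    (Module.finBasis F (bdry F C d i)) (h i) (fun k => secH F C d i (h i k))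
    (fun k => mk_secH i (h i k))
  have hZC : LinearMap.range (cyc F C d i).subtype = LinearMap.ker π := by
    rw [Submodule.range_subtype, hπ]
  obtain ⟨T, hT₁, hT₂⟩ := exists_basis_sum (Submodule.injective_subtype _) hZC S q
    (thirdFam F C d i) hq
  refine ⟨T.reindex (Equiv.sumAssoc _ _ _), ?_, ?_⟩
  · funext x
    rcases x with j | j | j
    · simp [torFam, hT₁, hS₁]
    · simp [torFam, hT₁, hS₂]
    · simp [torFam, hT₂]
  · intro σ τ ρ _ _ _ b z c hτ hρ
    have h1 : detSq F (T.reindex (Equiv.sumAssoc _ _ _)) T = 1 := by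
      rw [← detSq_self (T.reindex (Equiv.sumAssoc _ _ _)),
        ← detSq_comp_equiv _ (T.reindex _) (Equiv.sumAssoc _ _ _)]
      congr 1
      funext x
      simp
    rw [detSq_trans _ T, h1, one_mul, ← detSq_comp_equiv _ _ (Equiv.sumAssoc σ τ ρ)]
    have h2 : Sum.elim (fun j => (b j : C i)) (Sum.elim (fun j => (z j : C i)) c) ∘
        Equiv.sumAssoc σ τ ρ = Sum.elim (fun j => (cyc F C d i).subtype
          (Sum.elim (fun j => Submodule.inclusion hle (b j)) z j)) c := by
      funext x
      rcases x with (x | x) | x <;> simp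
    rw [h2, detSq_sumElim (f := (cyc F C d i).subtype) (g := π)
      (fun x => by rw [← LinearMap.mem_ker, ← hZC]; exact ⟨x, rfl⟩) S q T hT₁
      (fun j => by rw [hT₂, hq]) _ c hρ,
      detSq_sumElim (f := Submodule.inclusion hle) (g := P.mkQ)
      (fun x => by rw [← LinearMap.mem_ker, ← hBZ]; exact ⟨x, rfl⟩) _ (h i) S hS₁
      (fun j => by rw [hS₂]; exact mk_secH i _) b z hτ]
    rfl

lemma exists_basis_torFam (hd : ∀ i, (d i).comp (d (i + 1)) = 0)
    (h : ∀ i, Basis (κ i) F (hml F C d i)) (i : ℕ) :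
    ∃ T : Basis (Fin (finrank F (bdry F C d i)) ⊕ κ i ⊕ Fin (prevRank F C d i)) F (C i),
      ⇑T = torFam F C d h i ∧
      ∀ {σ τ ρ : Type} [Fintype σ] [Fintype τ] [Fintype ρ] (b : σ → bdry F C d i)
        (z : τ → cyc F C d i) (c : ρ → C i), Nonempty (τ ≃ κ i) →
        Nonempty (ρ ≃ Fin (prevRank F C d i)) →
        detSq F T (Sum.elim (fun j => (b j : C i)) (Sum.elim (fun j => (z j : C i)) c)) =
          detSq F (Module.finBasis F (bdry F C d i)) b *
            detSq F (h i) (fun j => (Submodule.Quotient.mk (z j) : hml F C d i)) *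
            prevDet d i c := by
  cases i with
  | zero =>
    let q : Basis (Fin (prevRank F C d 0)) F (Fin 0 → F) := Pi.basisFun F (Fin 0)
    obtain ⟨T, hT, hT'⟩ := exists_basis_torFam_of_surjective hd h 0 (0 : C 0 →ₗ[F] (Fin 0 → F))
      LinearMap.ker_zero.symm q (fun j => j.elim0)
    refine ⟨T, hT, fun b z c hτ hρ => ?_⟩
    rw [hT' b z c hτ hρ, detSq_eq_one_of_subsingleton hρ]
    rfl
  | succ i =>
    obtain ⟨T, hT, hT'⟩ := exists_basis_torFam_of_surjective hd h (i + 1) (d i).rangeRestrict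
      (LinearMap.ker_rangeRestrict (d i)).symm (Module.finBasis F (bdry F C d i))
      (fun j => Subtype.ext (d_secB i _))
    exact ⟨T, hT, hT'⟩

variable {ι : ℕ → Type} [∀ i, Fintype (ι i)]

lemma detSq_torFam_ne_zero (hd : ∀ i, (d i).comp (d (i + 1)) = 0)
    (e : ∀ i, Basis (ι i) F (C i)) (h : ∀ i, Basis (κ i) F (hml F C d i)) (i : ℕ) :
    detSq F (e i) (torFam F C d h i) ≠ 0 := by
  obtain ⟨T, hT, -⟩ := exists_basis_torFam hd h i
  rw [← hT]
  exact detSq_basis_ne_zero _ _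

/-- Comparison of an arbitrary family adapted to `B_i ⊆ Z_i ⊆ C_i` with the family computing the
torsion. -/
lemma detSq_adapted (hd : ∀ i, (d i).comp (d (i + 1)) = 0)
    (e : ∀ i, Basis (ι i) F (C i)) (h : ∀ i, Basis (κ i) F (hml F C d i)) (i : ℕ)
    {σ τ ρ : Type} [Fintype σ] [Fintype τ] [Fintype ρ] (b : σ → bdry F C d i)
    (z : τ → cyc F C d i) (c : ρ → C i) (hτ : Nonempty (τ ≃ κ i))
    (hρ : Nonempty (ρ ≃ Fin (prevRank F C d i))) :
    detSq F (e i) (Sum.elim (fun j => (b j : C i)) (Sum.elim (fun j => (z j : C i)) c)) =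
      detSq F (e i) (torFam F C d h i) *
        (detSq F (Module.finBasis F (bdry F C d i)) b *
          detSq F (h i) (fun j => (Submodule.Quotient.mk (z j) : hml F C d i)) *
          prevDet d i c) := by
  obtain ⟨T, hT, hT'⟩ := exists_basis_torFam hd h i
  rw [detSq_trans (e i) T, hT' b z c hτ hρ, hT]

lemma detSq_adapted_finBasis (hd : ∀ i, (d i).comp (d (i + 1)) = 0)
    (e : ∀ i, Basis (ι i) F (C i)) (h : ∀ i, Basis (κ i) F (hml F C d i)) (i : ℕ)
    {τ : Type} [Fintype τ] (z : τ → cyc F C d i) (hτ : Nonempty (τ ≃ κ i)) :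
    detSq F (e i) (Sum.elim (fun j => (Module.finBasis F (bdry F C d i) j : C i))
      (Sum.elim (fun j => (z j : C i)) (thirdFam F C d i))) =
      detSq F (e i) (torFam F C d h i) *
        detSq F (h i) (fun j => (Submodule.Quotient.mk (z j) : hml F C d i)) := by
  rw [detSq_adapted hd e h i _ z _ hτ ⟨Equiv.refl _⟩, detSq_self, prevDet_thirdFam, one_mul,
    mul_one]

lemma torsionHat_sq (n : ℕ) (e : ∀ i, Basis (ι i) F (C i))
    (h : ∀ i, Basis (κ i) F (hml F C d i)) :
    torsionHat F C d n e h ^ 2 =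
      ∏ i ∈ Finset.range (n + 1), detSq F (e i) (torFam F C d h i) ^ ((-1 : ℤ) ^ (i + 1)) := by
  rw [torsionHat, ← Finset.prod_pow]
  refine Finset.prod_congr rfl fun i _ => ?_
  rw [detSq, ← zpow_natCast, ← zpow_natCast, ← zpow_mul, ← zpow_mul, mul_comm]

end TorFam

section Acyclic

variable {F}

/-- A chosen linear right inverse of a linear map onto its range. -/
def linSec {X Y : Type} [AddCommGroup X] [Module F X] [AddCommGroup Y] [Module F Y]
    (q : X →ₗ[F] Y) : LinearMap.range q →ₗ[F] X :=
  (q.rangeRestrict.exists_rightInverse_of_surjective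
    (LinearMap.range_eq_top.mpr q.surjective_rangeRestrict)).choose

lemma apply_linSec {X Y : Type} [AddCommGroup X] [Module F X] [AddCommGroup Y] [Module F Y]
    (q : X →ₗ[F] Y) (y : LinearMap.range q) : q (linSec q y) = y :=
  congrArg Subtype.val (LinearMap.congr_fun (q.rangeRestrict.exists_rightInverse_of_surjective
    (LinearMap.range_eq_top.mpr q.surjective_rangeRestrict)).choose_spec y)

/-- The contribution to the torsion of the middle term of an exact sequence `X → Y → Z`. -/
def exactDet {X Y Z υ : Type} [AddCommGroup X] [Module F X] [AddCommGroup Y] [Module F Y]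
    [AddCommGroup Z] [Module F Z] [FiniteDimensional F X] [FiniteDimensional F Y] [Fintype υ]
    (p : X →ₗ[F] Y) (q : Y →ₗ[F] Z) (y : Basis υ F Y) : F :=
  detSq F y (Sum.elim (fun j => (Module.finBasis F (LinearMap.range p) j : Y))
    (fun j => linSec q (Module.finBasis F (LinearMap.range q) j)))

variable {C : ℕ → Type} [∀ i, AddCommGroup (C i)] [∀ i, Module F (C i)]
  {d : ∀ i, C (i + 1) →ₗ[F] C i}

lemma finrank_hml_eq_zero {i : ℕ} (hC : bdry F C d i = cyc F C d i) :
    finrank F (hml F C d i) = 0 := by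
  have : Subsingleton (hml F C d i) := by
    rw [Submodule.Quotient.subsingleton_iff, hC]
    exact Submodule.comap_subtype_self _
  exact Module.finrank_zero_of_subsingleton

variable [∀ i, FiniteDimensional F (C i)] {ι : ℕ → Type} [∀ i, Fintype (ι i)]

lemma detSq_torFam_zero (hC : bdry F C d 0 = cyc F C d 0) (e : ∀ i, Basis (ι i) F (C i)) :
    detSq F (e 0) (torFam F C d (fun i => Module.finBasis F (hml F C d i)) 0) =
      detSq F (e 0) (fun j => (Module.finBasis F (LinearMap.range (d 0)) j : C 0)) := by
  have : IsEmpty (Fin (finrank F (hml F C d 0))) := by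
    rw [finrank_hml_eq_zero hC]
    infer_instance
  have : IsEmpty (Fin (prevRank F C d 0)) := inferInstanceAs (IsEmpty (Fin 0))
  exact (detSq_comp_equiv (e 0) _ (Equiv.sumEmpty (Fin (finrank F (bdry F C d 0)))
    (Fin (finrank F (hml F C d 0)) ⊕ Fin (prevRank F C d 0))).symm).symm

lemma detSq_torFam_succ {i : ℕ} (hC : bdry F C d (i + 1) = cyc F C d (i + 1))
    (e : ∀ i, Basis (ι i) F (C i)) :
    detSq F (e (i + 1)) (torFam F C d (fun i => Module.finBasis F (hml F C d i)) (i + 1)) =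
      exactDet (d (i + 1)) (d i) (e (i + 1)) := by
  have : IsEmpty (Fin (finrank F (hml F C d (i + 1)))) := by
    rw [finrank_hml_eq_zero hC]
    infer_instance
  refine (detSq_comp_equiv (e (i + 1)) _
    (Equiv.sumCongr (Equiv.refl (Fin (finrank F (bdry F C d (i + 1)))))
      (Equiv.emptySum (Fin (finrank F (hml F C d (i + 1)))) _).symm)).symm.trans ?_
  rw [exactDet]
  congr 1
  funext x
  rcases x with x | x <;> rfl

lemma torsion_sq (hC : ∀ i, bdry F C d i = cyc F C d i) (n : ℕ)
    (e : ∀ i, Basis (ι i) F (C i)) :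
    torsion F C d n e ^ 2 = ∏ i ∈ Finset.range (n + 1), detSq F (e i)
      (torFam F C d (fun i => Module.finBasis F (hml F C d i)) i) ^ ((-1 : ℤ) ^ (i + 1)) := by
  rw [_root_.torsion, if_pos hC, torsionHat_sq]

lemma detSq_torFam_zero_ne_zero (hC : ∀ i, bdry F C d i = cyc F C d i)
    (e : ∀ i, Basis (ι i) F (C i)) :
    detSq F (e 0) (fun j => (Module.finBasis F (LinearMap.range (d 0)) j : C 0)) ≠ 0 := by
  rw [← detSq_torFam_zero (hC 0)]
  exact detSq_torFam_ne_zero (fun i => LinearMap.ext fun x =>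
    (hC (i + 1)).le (LinearMap.mem_range_self _ x)) e _ 0

lemma exactDet_ne_zero (hC : ∀ i, bdry F C d i = cyc F C d i)
    (e : ∀ i, Basis (ι i) F (C i)) (i : ℕ) : exactDet (d (i + 1)) (d i) (e (i + 1)) ≠ 0 := by
  rw [← detSq_torFam_succ (hC (i + 1))]
  exact detSq_torFam_ne_zero (fun i => LinearMap.ext fun x =>
    (hC (i + 1)).le (LinearMap.mem_range_self _ x)) e _ (i + 1)

end Acyclic

section LongExact

variable {F}

lemma range_dL3_eq_ker : ∀ (A B C : ℕ → Type) [∀ i, AddCommGroup (A i)]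
    [∀ i, AddCommGroup (B i)] [∀ i, AddCommGroup (C i)] [∀ i, Module F (A i)]
    [∀ i, Module F (B i)] [∀ i, Module F (C i)]
    (a : ∀ i, B i →ₗ[F] A i) (b : ∀ i, C i →ₗ[F] B i) (c : ∀ i, A (i + 1) →ₗ[F] C i),
    (∀ i, LinearMap.range (b i) = LinearMap.ker (a i)) →
    (∀ i, LinearMap.range (c i) = LinearMap.ker (b i)) →
    (∀ i, LinearMap.range (a (i + 1)) = LinearMap.ker (c i)) →
    ∀ j, LinearMap.range (dL3 F A B C a b c (j + 1)) = LinearMap.ker (dL3 F A B C a b c j)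
  | _, _, _, _, _, _, _, _, _, _, _, _, hb, _, _, 0 => hb 0
  | _, _, _, _, _, _, _, _, _, _, _, _, _, hc, _, 1 => hc 0
  | _, _, _, _, _, _, _, _, _, _, _, _, _, _, ha, 2 => ha 0
  | A, B, C, _, _, _, _, _, _, a, b, c, hb, hc, ha, (j + 3) =>
    range_dL3_eq_ker (fun i => A (i + 1)) (fun i => B (i + 1)) (fun i => C (i + 1))
      (fun i => a (i + 1)) (fun i => b (i + 1)) (fun i => c (i + 1))
      (fun i => hb (i + 1)) (fun i => hc (i + 1)) (fun i => ha (i + 1)) j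

lemma exactDet_dL3_one : ∀ (A B C : ℕ → Type) [∀ i, AddCommGroup (A i)]
    [∀ i, AddCommGroup (B i)] [∀ i, AddCommGroup (C i)] [∀ i, Module F (A i)]
    [∀ i, Module F (B i)] [∀ i, Module F (C i)] [∀ i, FiniteDimensional F (A i)]
    [∀ i, FiniteDimensional F (B i)] [∀ i, FiniteDimensional F (C i)]
    (a : ∀ i, B i →ₗ[F] A i) (b : ∀ i, C i →ₗ[F] B i) (c : ∀ i, A (i + 1) →ₗ[F] C i)
    (κA κB κC : ℕ → Type) [∀ i, Fintype (κA i)] [∀ i, Fintype (κB i)] [∀ i, Fintype (κC i)]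
    (bA : ∀ i, Basis (κA i) F (A i)) (bB : ∀ i, Basis (κB i) F (B i))
    (bC : ∀ i, Basis (κC i) F (C i)) (i : ℕ),
    exactDet (dL3 F A B C a b c (3 * i + 1)) (dL3 F A B C a b c (3 * i))
      (L3basis F A B C κA κB κC bA bB bC (3 * i + 1)) = exactDet (b i) (a i) (bB i)
  | _, _, _, _, _, _, _, _, _, _, _, _, _, _, _, _, _, _, _, _, _, _, _, _, 0 => rfl
  | A, B, C, _, _, _, _, _, _, _, _, _, a, b, c, κA, κB, κC, _, _, _, bA, bB, bC, i + 1 =>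
    exactDet_dL3_one (fun i => A (i + 1)) (fun i => B (i + 1)) (fun i => C (i + 1))
      (fun i => a (i + 1)) (fun i => b (i + 1)) (fun i => c (i + 1))
      (fun i => κA (i + 1)) (fun i => κB (i + 1)) (fun i => κC (i + 1))
      (fun i => bA (i + 1)) (fun i => bB (i + 1)) (fun i => bC (i + 1)) i

lemma exactDet_dL3_two : ∀ (A B C : ℕ → Type) [∀ i, AddCommGroup (A i)]
    [∀ i, AddCommGroup (B i)] [∀ i, AddCommGroup (C i)] [∀ i, Module F (A i)]
    [∀ i, Module F (B i)] [∀ i, Module F (C i)] [∀ i, FiniteDimensional F (A i)]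
    [∀ i, FiniteDimensional F (B i)] [∀ i, FiniteDimensional F (C i)]
    (a : ∀ i, B i →ₗ[F] A i) (b : ∀ i, C i →ₗ[F] B i) (c : ∀ i, A (i + 1) →ₗ[F] C i)
    (κA κB κC : ℕ → Type) [∀ i, Fintype (κA i)] [∀ i, Fintype (κB i)] [∀ i, Fintype (κC i)]
    (bA : ∀ i, Basis (κA i) F (A i)) (bB : ∀ i, Basis (κB i) F (B i))
    (bC : ∀ i, Basis (κC i) F (C i)) (i : ℕ),
    exactDet (dL3 F A B C a b c (3 * i + 2)) (dL3 F A B C a b c (3 * i + 1))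
      (L3basis F A B C κA κB κC bA bB bC (3 * i + 2)) = exactDet (c i) (b i) (bC i)
  | _, _, _, _, _, _, _, _, _, _, _, _, _, _, _, _, _, _, _, _, _, _, _, _, 0 => rfl
  | A, B, C, _, _, _, _, _, _, _, _, _, a, b, c, κA, κB, κC, _, _, _, bA, bB, bC, i + 1 =>
    exactDet_dL3_two (fun i => A (i + 1)) (fun i => B (i + 1)) (fun i => C (i + 1))
      (fun i => a (i + 1)) (fun i => b (i + 1)) (fun i => c (i + 1))
      (fun i => κA (i + 1)) (fun i => κB (i + 1)) (fun i => κC (i + 1))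
      (fun i => bA (i + 1)) (fun i => bB (i + 1)) (fun i => bC (i + 1)) i

lemma exactDet_dL3_three : ∀ (A B C : ℕ → Type) [∀ i, AddCommGroup (A i)]
    [∀ i, AddCommGroup (B i)] [∀ i, AddCommGroup (C i)] [∀ i, Module F (A i)]
    [∀ i, Module F (B i)] [∀ i, Module F (C i)] [∀ i, FiniteDimensional F (A i)]
    [∀ i, FiniteDimensional F (B i)] [∀ i, FiniteDimensional F (C i)]
    (a : ∀ i, B i →ₗ[F] A i) (b : ∀ i, C i →ₗ[F] B i) (c : ∀ i, A (i + 1) →ₗ[F] C i)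
    (κA κB κC : ℕ → Type) [∀ i, Fintype (κA i)] [∀ i, Fintype (κB i)] [∀ i, Fintype (κC i)]
    (bA : ∀ i, Basis (κA i) F (A i)) (bB : ∀ i, Basis (κB i) F (B i))
    (bC : ∀ i, Basis (κC i) F (C i)) (i : ℕ),
    exactDet (dL3 F A B C a b c (3 * i + 3)) (dL3 F A B C a b c (3 * i + 2))
      (L3basis F A B C κA κB κC bA bB bC (3 * i + 3)) =
      exactDet (a (i + 1)) (c i) (bA (i + 1))
  | _, _, _, _, _, _, _, _, _, _, _, _, _, _, _, _, _, _, _, _, _, _, _, _, 0 => rfl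
  | A, B, C, _, _, _, _, _, _, _, _, _, a, b, c, κA, κB, κC, _, _, _, bA, bB, bC, i + 1 =>
    exactDet_dL3_three (fun i => A (i + 1)) (fun i => B (i + 1)) (fun i => C (i + 1))
      (fun i => a (i + 1)) (fun i => b (i + 1)) (fun i => c (i + 1))
      (fun i => κA (i + 1)) (fun i => κB (i + 1)) (fun i => κC (i + 1))
      (fun i => bA (i + 1)) (fun i => bB (i + 1)) (fun i => bC (i + 1)) i

end LongExact

section HomologySequence

variable {F}
variable {C C' C'' : ℕ → Type}
  [∀ i, AddCommGroup (C i)] [∀ i, Module F (C i)]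
  [∀ i, AddCommGroup (C' i)] [∀ i, Module F (C' i)]
  [∀ i, AddCommGroup (C'' i)] [∀ i, Module F (C'' i)]

lemma mk_eq_zero_iff {d : ∀ i, C (i + 1) →ₗ[F] C i} {i : ℕ} (z : cyc F C d i) :
    (Submodule.Quotient.mk z : hml F C d i) = 0 ↔ (z : C i) ∈ bdry F C d i := by
  rw [Submodule.Quotient.mk_eq_zero]
  rfl

lemma mk_eq_mk_iff {d : ∀ i, C (i + 1) →ₗ[F] C i} {i : ℕ} (z w : cyc F C d i) :
    (Submodule.Quotient.mk z : hml F C d i) = Submodule.Quotient.mk w ↔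
      (z : C i) - w ∈ bdry F C d i := by
  rw [Submodule.Quotient.eq]
  rfl

/-- The regrouping of the index set of an adapted family of the middle complex. -/
def adaptedEquiv (A₁ A₂ A₃ A₄ B₁ B₂ B₃ B₄ : Type) :
    (A₁ ⊕ (A₂ ⊕ A₃) ⊕ A₄) ⊕ (B₁ ⊕ (B₂ ⊕ B₃) ⊕ B₄) ≃
      ((A₁ ⊕ A₂) ⊕ B₁) ⊕ (A₃ ⊕ B₂) ⊕ ((A₄ ⊕ B₃) ⊕ B₄) where
  toFun
    | .inl (.inl x) => .inl (.inl (.inl x))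
    | .inl (.inr (.inl (.inl x))) => .inl (.inl (.inr x))
    | .inl (.inr (.inl (.inr x))) => .inr (.inl (.inl x))
    | .inl (.inr (.inr x)) => .inr (.inr (.inl (.inl x)))
    | .inr (.inl x) => .inl (.inr x)
    | .inr (.inr (.inl (.inl x))) => .inr (.inl (.inr x))
    | .inr (.inr (.inl (.inr x))) => .inr (.inr (.inl (.inr x)))
    | .inr (.inr (.inr x)) => .inr (.inr (.inr x))
  invFun
    | .inl (.inl (.inl x)) => .inl (.inl x)
    | .inl (.inl (.inr x)) => .inl (.inr (.inl (.inl x)))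
    | .inr (.inl (.inl x)) => .inl (.inr (.inl (.inr x)))
    | .inr (.inr (.inl (.inl x))) => .inl (.inr (.inr x))
    | .inl (.inr x) => .inr (.inl x)
    | .inr (.inl (.inr x)) => .inr (.inr (.inl (.inl x)))
    | .inr (.inr (.inl (.inr x))) => .inr (.inr (.inl (.inr x)))
    | .inr (.inr (.inr x)) => .inr (.inr (.inr x))
  left_inv := by rintro ((x | (x | x) | x) | (x | (x | x) | x)) <;> rfl
  right_inv := by rintro (((x | x) | x) | (x | x) | ((x | x) | x)) <;> rfl

/-- A short exact sequence of chain complexes together with the maps of its long exact homology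
sequence, characterized by their values on representatives. -/
structure IsHomologySequence
    (d : ∀ i, C (i + 1) →ₗ[F] C i) (d' : ∀ i, C' (i + 1) →ₗ[F] C' i)
    (d'' : ∀ i, C'' (i + 1) →ₗ[F] C'' i)
    (f : ∀ i, C i →ₗ[F] C' i) (g : ∀ i, C' i →ₗ[F] C'' i)
    (fH : ∀ i, hml F C d i →ₗ[F] hml F C' d' i) (gH : ∀ i, hml F C' d' i →ₗ[F] hml F C'' d'' i)
    (δ : ∀ i, hml F C'' d'' (i + 1) →ₗ[F] hml F C d i) : Prop where
  d_comp : ∀ i, (d i).comp (d (i + 1)) = 0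
  d_comp' : ∀ i, (d' i).comp (d' (i + 1)) = 0
  d_comp'' : ∀ i, (d'' i).comp (d'' (i + 1)) = 0
  f_comm : ∀ i x, f i (d i x) = d' i (f (i + 1) x)
  g_comm : ∀ i x, g i (d' i x) = d'' i (g (i + 1) x)
  f_inj : ∀ i, Function.Injective (f i)
  g_surj : ∀ i, Function.Surjective (g i)
  range_f : ∀ i, LinearMap.range (f i) = LinearMap.ker (g i)
  fH_mk : ∀ i (z : cyc F C d i) (hz : f i z ∈ cyc F C' d' i),
    fH i (Submodule.Quotient.mk z) = Submodule.Quotient.mk ⟨f i z, hz⟩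
  gH_mk : ∀ i (z : cyc F C' d' i) (hz : g i z ∈ cyc F C'' d'' i),
    gH i (Submodule.Quotient.mk z) = Submodule.Quotient.mk ⟨g i z, hz⟩
  δ_mk : ∀ i (x : C' (i + 1)) (hx : g (i + 1) x ∈ cyc F C'' d'' (i + 1)) (a : C i)
    (_ : f i a = d' i x) (ha : a ∈ cyc F C d i),
    δ i (Submodule.Quotient.mk ⟨g (i + 1) x, hx⟩) = Submodule.Quotient.mk ⟨a, ha⟩

namespace IsHomologySequence

variable {d : ∀ i, C (i + 1) →ₗ[F] C i} {d' : ∀ i, C' (i + 1) →ₗ[F] C' i}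
  {d'' : ∀ i, C'' (i + 1) →ₗ[F] C'' i}
  {f : ∀ i, C i →ₗ[F] C' i} {g : ∀ i, C' i →ₗ[F] C'' i}
  {fH : ∀ i, hml F C d i →ₗ[F] hml F C' d' i} {gH : ∀ i, hml F C' d' i →ₗ[F] hml F C'' d'' i}
  {δ : ∀ i, hml F C'' d'' (i + 1) →ₗ[F] hml F C d i}

/-- The rank of `δ_{i-1}` (zero for `i = 0`). -/
def rankPrev (δ : ∀ i, hml F C'' d'' (i + 1) →ₗ[F] hml F C d i) : ℕ → ℕ
  | 0 => 0
  | i + 1 => finrank F (LinearMap.range (δ i))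

/-- A chosen lift to `H_i(C'')` of a basis of the range of `δ_{i-1}` (empty for `i = 0`). -/
def liftPrev [∀ i, FiniteDimensional F (C i)]
    (δ : ∀ i, hml F C'' d'' (i + 1) →ₗ[F] hml F C d i) :
    ∀ i, Fin (rankPrev δ i) → hml F C'' d'' i
  | 0 => fun j => j.elim0
  | i + 1 => fun j => linSec (δ i) (Module.finBasis F (LinearMap.range (δ i)) j)

/-- The contribution of `H_i(C'')` to the torsion of the long exact homology sequence. -/
def quotDet [∀ i, FiniteDimensional F (C i)] [∀ i, FiniteDimensional F (C'' i)] {κ'' : Type} [Fintype κ'']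
    (gH : ∀ i, hml F C' d' i →ₗ[F] hml F C'' d'' i)
    (δ : ∀ i, hml F C'' d'' (i + 1) →ₗ[F] hml F C d i) (i : ℕ)
    (h'' : Basis κ'' F (hml F C'' d'' i)) : F :=
  detSq F h'' (Sum.elim (fun j => (Module.finBasis F (LinearMap.range (gH i)) j : hml F C'' d'' i))
    (liftPrev δ i))

lemma quotDet_zero [∀ i, FiniteDimensional F (C i)] [∀ i, FiniteDimensional F (C'' i)]
    {κ₀ : Type} [Fintype κ₀] (b : Basis κ₀ F (hml F C'' d'' 0)) :
    quotDet gH δ 0 b = detSq F b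
      (fun j => (Module.finBasis F (LinearMap.range (gH 0)) j : hml F C'' d'' 0)) := by
  have : IsEmpty (Fin (rankPrev δ 0)) := inferInstanceAs (IsEmpty (Fin 0))
  exact (detSq_comp_equiv b _ (Equiv.sumEmpty (Fin (finrank F (LinearMap.range (gH 0))))
    (Fin (rankPrev δ 0))).symm).symm

variable (S : IsHomologySequence d d' d'' f g fH gH δ)

include S

lemma g_f (i : ℕ) (x : C i) : g i (f i x) = 0 := by
  rw [← LinearMap.mem_ker, ← S.range_f]
  exact LinearMap.mem_range_self _ x

lemma exists_f_eq {i : ℕ} {y : C' i} (hy : g i y = 0) : ∃ x, f i x = y := by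
  rw [← LinearMap.mem_ker, ← S.range_f] at hy
  exact hy

lemma f_mem_cyc_iff (i : ℕ) (x : C i) : f i x ∈ cyc F C' d' i ↔ x ∈ cyc F C d i := by
  cases i with
  | zero => exact ⟨fun _ => trivial, fun _ => trivial⟩
  | succ i =>
    change d' i (f (i + 1) x) = 0 ↔ d i x = 0
    rw [← S.f_comm, map_eq_zero_iff _ (S.f_inj i)]

lemma g_mem_cyc {i : ℕ} {x : C' i} (hx : x ∈ cyc F C' d' i) : g i x ∈ cyc F C'' d'' i := by
  cases i with
  | zero => trivial
  | succ i =>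
    change d'' i (g (i + 1) x) = 0
    rw [← S.g_comm, show d' i x = 0 from hx, map_zero]

lemma f_mem_bdry {i : ℕ} {x : C i} (hx : x ∈ bdry F C d i) : f i x ∈ bdry F C' d' i := by
  obtain ⟨y, rfl⟩ := hx
  exact ⟨f (i + 1) y, (S.f_comm i y).symm⟩

lemma range_fH (i : ℕ) : LinearMap.range (fH i) = LinearMap.ker (gH i) := by
  apply le_antisymm
  · rintro _ ⟨x, rfl⟩
    obtain ⟨z, rfl⟩ := Submodule.Quotient.mk_surjective _ x
    have hz := (S.f_mem_cyc_iff i z).mpr z.2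
    rw [LinearMap.mem_ker, S.fH_mk i z hz, S.gH_mk i _ (S.g_mem_cyc hz), mk_eq_zero_iff]
    change g i (f i z) ∈ _
    rw [S.g_f]
    exact zero_mem _
  · intro x hx
    obtain ⟨z, rfl⟩ := Submodule.Quotient.mk_surjective _ x
    rw [LinearMap.mem_ker, S.gH_mk i z (S.g_mem_cyc z.2), mk_eq_zero_iff] at hx
    obtain ⟨y, hy⟩ := hx
    obtain ⟨x, rfl⟩ := S.g_surj (i + 1) y
    rw [← S.g_comm] at hy
    obtain ⟨a, ha⟩ := S.exists_f_eq (y := (z : C' i) - d' i x) (by rw [map_sub, hy]; exact sub_self _)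
    have hfa : f i a ∈ cyc F C' d' i := by
      rw [ha]
      exact sub_mem z.2 (bdry_le_cyc S.d_comp' i (LinearMap.mem_range_self _ x))
    refine ⟨Submodule.Quotient.mk ⟨a, (S.f_mem_cyc_iff i a).mp hfa⟩, ?_⟩
    rw [S.fH_mk i _ hfa, mk_eq_mk_iff]
    refine ⟨-x, ?_⟩
    change _ = f i a - z
    rw [ha, map_neg]
    abel

lemma range_δ (i : ℕ) : LinearMap.range (δ i) = LinearMap.ker (fH i) := by
  apply le_antisymm
  · rintro _ ⟨x, rfl⟩
    obtain ⟨⟨z, hz⟩, rfl⟩ := Submodule.Quotient.mk_surjective _ x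
    obtain ⟨c, rfl⟩ := S.g_surj (i + 1) z
    obtain ⟨a, ha⟩ := S.exists_f_eq (y := d' i c) (by rw [S.g_comm]; exact hz)
    have hfa : f i a ∈ cyc F C' d' i :=
      bdry_le_cyc S.d_comp' i (ha ▸ LinearMap.mem_range_self _ c)
    rw [LinearMap.mem_ker, S.δ_mk i c hz a ha ((S.f_mem_cyc_iff i a).mp hfa), S.fH_mk i _ hfa,
      mk_eq_zero_iff]
    exact ⟨c, ha.symm⟩
  · intro x hx
    obtain ⟨z, rfl⟩ := Submodule.Quotient.mk_surjective _ x
    rw [LinearMap.mem_ker, S.fH_mk i z ((S.f_mem_cyc_iff i z).mpr z.2), mk_eq_zero_iff] at hx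
    obtain ⟨c, hc⟩ := hx
    have hgc : g (i + 1) c ∈ cyc F C'' d'' (i + 1) := by
      change d'' i (g (i + 1) c) = 0
      rw [← S.g_comm, hc]
      exact S.g_f i z
    exact ⟨_, S.δ_mk i c hgc z hc.symm z.2⟩

lemma range_gH_succ (i : ℕ) : LinearMap.range (gH (i + 1)) = LinearMap.ker (δ i) := by
  apply le_antisymm
  · rintro _ ⟨x, rfl⟩
    obtain ⟨z, rfl⟩ := Submodule.Quotient.mk_surjective _ x
    have hz : d' i z = 0 := z.2
    rw [LinearMap.mem_ker, S.gH_mk _ z (S.g_mem_cyc z.2),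
      S.δ_mk i z (S.g_mem_cyc z.2) 0 (by rw [map_zero, hz]) (zero_mem _), mk_eq_zero_iff]
    exact zero_mem _
  · intro x hx
    obtain ⟨⟨z, hz⟩, rfl⟩ := Submodule.Quotient.mk_surjective _ x
    obtain ⟨c, rfl⟩ := S.g_surj (i + 1) z
    obtain ⟨a, ha⟩ := S.exists_f_eq (y := d' i c) (by rw [S.g_comm]; exact hz)
    have hfa : f i a ∈ cyc F C' d' i :=
      bdry_le_cyc S.d_comp' i (ha ▸ LinearMap.mem_range_self _ c)
    rw [LinearMap.mem_ker, S.δ_mk i c hz a ha ((S.f_mem_cyc_iff i a).mp hfa),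
      mk_eq_zero_iff] at hx
    obtain ⟨y, hy⟩ := hx
    have hcy : c - f (i + 1) y ∈ cyc F C' d' (i + 1) := by
      change d' i (c - f (i + 1) y) = 0
      rw [map_sub, ← S.f_comm, hy, ← ha]
      exact sub_self _
    refine ⟨Submodule.Quotient.mk ⟨_, hcy⟩, ?_⟩
    rw [S.gH_mk _ _ (S.g_mem_cyc hcy)]
    congr 2
    change g (i + 1) (c - f (i + 1) y) = _
    rw [map_sub, S.g_f, sub_zero]

lemma range_gH_zero : LinearMap.range (gH 0) = ⊤ := by
  rw [LinearMap.range_eq_top]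
  intro x
  obtain ⟨⟨z, hz⟩, rfl⟩ := Submodule.Quotient.mk_surjective _ x
  obtain ⟨c, rfl⟩ := S.g_surj 0 z
  exact ⟨Submodule.Quotient.mk ⟨c, trivial⟩, S.gH_mk 0 ⟨c, trivial⟩ hz⟩

lemma bdry_eq_cyc : ∀ j, bdry F
      (L3 (fun i => hml F C'' d'' i) (fun i => hml F C' d' i) (fun i => hml F C d i))
      (dL3 F (fun i => hml F C'' d'' i) (fun i => hml F C' d' i) (fun i => hml F C d i) gH fH δ) j =
    cyc F (L3 (fun i => hml F C'' d'' i) (fun i => hml F C' d' i) (fun i => hml F C d i))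
      (dL3 F (fun i => hml F C'' d'' i) (fun i => hml F C' d' i) (fun i => hml F C d i) gH fH δ) j
  | 0 => S.range_gH_zero
  | j + 1 => range_dL3_eq_ker _ _ _ gH fH δ S.range_fH S.range_δ S.range_gH_succ j

variable [∀ i, FiniteDimensional F (C i)] [∀ i, FiniteDimensional F (C' i)]
  [∀ i, FiniteDimensional F (C'' i)]

variable {ι ι'' κ κ' κ'' : ℕ → Type} [∀ i, Fintype (ι i)] [∀ i, Fintype (ι'' i)]
  [∀ i, Fintype (κ i)] [∀ i, Fintype (κ' i)] [∀ i, Fintype (κ'' i)]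

/-- The product formula in each degree, up to factors `β i` that cancel in the alternating
product. -/
lemma exists_detSq_mul_eq
    (e : ∀ i, Basis (ι i) F (C i)) (e'' : ∀ i, Basis (ι'' i) F (C'' i))
    (e' : ∀ i, Basis (ι i ⊕ ι'' i) F (C' i))
    (he'f : ∀ i j, e' i (Sum.inl j) = f i (e i j))
    (he'g : ∀ i k, g i (e' i (Sum.inr k)) = e'' i k)
    (h : ∀ i, Basis (κ i) F (hml F C d i)) (h' : ∀ i, Basis (κ' i) F (hml F C' d' i))
    (h'' : ∀ i, Basis (κ'' i) F (hml F C'' d'' i))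
    (hl : ∀ i, exactDet (δ i) (fH i) (h i) ≠ 0) (hl' : ∀ i, exactDet (fH i) (gH i) (h' i) ≠ 0)
    (hl'' : ∀ i, quotDet gH δ i (h'' i) ≠ 0) :
    ∃ β β' : ℕ → F, (∀ i, β i ≠ 0) ∧ (∀ i, Subsingleton (C' (i + 1)) → β i = 1) ∧ β' 0 = 1 ∧
      (∀ i, β' (i + 1) = β i) ∧
      ∀ i, detSq F (e' i) (torFam F C' d' h' i) *
          (β i * exactDet (fH i) (gH i) (h' i) * β' i) =
        (detSq F (e i) (torFam F C d h i) * exactDet (δ i) (fH i) (h i)) *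
          (detSq F (e'' i) (torFam F C'' d'' h'' i) * quotDet gH δ i (h'' i)) := by
  choose s hs using fun i => (g i).exists_rightInverse_of_surjective
    (LinearMap.range_eq_top.mpr (S.g_surj i))
  replace hs : ∀ i x, g i (s i x) = x := fun i x => LinearMap.congr_fun (hs i) x
  -- lifts of bases of the images of the maps of the homology sequence
  let r : ∀ i, Fin (rankPrev δ i) → cyc F C'' d'' i :=
    fun i j => secH F C'' d'' i (liftPrev δ i j)
  have hr : ∀ i j, (Submodule.Quotient.mk (r i j) : hml F C'' d'' i) = liftPrev δ i j :=
    fun i j => mk_secH i _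
  have hk : ∀ i (j : Fin (finrank F (LinearMap.range (δ i)))),
      ∃ x, f i x = d' i (s (i + 1) (r (i + 1) j)) := fun i j => S.exists_f_eq (by
    rw [S.g_comm, hs]
    exact (r (i + 1) j).2)
  choose k hk using hk
  have hfkB : ∀ i j, f i (k i j) ∈ bdry F C' d' i := fun i j => by
    rw [hk]
    exact LinearMap.mem_range_self _ _
  have hkZ : ∀ i j, k i j ∈ cyc F C d i := fun i j =>
    (S.f_mem_cyc_iff i _).mp (bdry_le_cyc S.d_comp' i (hfkB i j))
  have hkH : ∀ i j, (Submodule.Quotient.mk ⟨k i j, hkZ i j⟩ : hml F C d i) =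
      Module.finBasis F (LinearMap.range (δ i)) j := fun i j => by
    have hgs : g (i + 1) (s (i + 1) (r (i + 1) j)) ∈ cyc F C'' d'' (i + 1) := by
      rw [hs]
      exact (r (i + 1) j).2
    rw [← S.δ_mk i _ hgs (k i j) (hk i j) (hkZ i j), ← apply_linSec (δ i)]
    congr 1
    refine Eq.trans ?_ (hr (i + 1) j)
    congr 1
    exact Subtype.ext (hs _ _)
  let p : ∀ i, Fin (finrank F (LinearMap.range (fH i))) → cyc F C d i :=
    fun i j => secH F C d i (linSec (fH i) (Module.finBasis F (LinearMap.range (fH i)) j))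
  have hfpZ : ∀ i j, f i (p i j) ∈ cyc F C' d' i := fun i j => (S.f_mem_cyc_iff i _).mpr (p i j).2
  have hfpH : ∀ i j, (Submodule.Quotient.mk ⟨f i (p i j), hfpZ i j⟩ : hml F C' d' i) =
      Module.finBasis F (LinearMap.range (fH i)) j := fun i j => by
    rw [← S.fH_mk i (p i j), mk_secH, apply_linSec]
  let q : ∀ i, Fin (finrank F (LinearMap.range (gH i))) → cyc F C' d' i :=
    fun i j => secH F C' d' i (linSec (gH i) (Module.finBasis F (LinearMap.range (gH i)) j))
  have hgqZ : ∀ i j, g i (q i j) ∈ cyc F C'' d'' i := fun i j => S.g_mem_cyc (q i j).2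
  have hgqH : ∀ i j, (Submodule.Quotient.mk ⟨g i (q i j), hgqZ i j⟩ : hml F C'' d'' i) =
      Module.finBasis F (LinearMap.range (gH i)) j := fun i j => by
    rw [← S.gH_mk i (q i j), mk_secH, apply_linSec]
  -- adapted families of cycles
  let z : ∀ i, _ → cyc F C d i := fun i => Sum.elim (fun j => ⟨k i j, hkZ i j⟩) (p i)
  let z' : ∀ i, _ → cyc F C' d' i := fun i => Sum.elim (fun j => ⟨f i (p i j), hfpZ i j⟩) (q i)
  let z'' : ∀ i, _ → cyc F C'' d'' i :=
    fun i => Sum.elim (fun j => ⟨g i (q i j), hgqZ i j⟩) (r i)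
  have hz : ∀ i, detSq F (h i) (fun j => (Submodule.Quotient.mk (z i j) : hml F C d i)) =
      exactDet (δ i) (fH i) (h i) := fun i => by
    rw [exactDet]
    congr 1
    funext x
    rcases x with x | x
    · exact hkH i x
    · exact mk_secH i _
  have hz' : ∀ i, detSq F (h' i) (fun j => (Submodule.Quotient.mk (z' i j) : hml F C' d' i)) =
      exactDet (fH i) (gH i) (h' i) := fun i => by
    rw [exactDet]
    congr 1
    funext x
    rcases x with x | x
    · exact hfpH i x
    · exact mk_secH i _
  have hz'' : ∀ i, detSq F (h'' i)
      (fun j => (Submodule.Quotient.mk (z'' i j) : hml F C'' d'' i)) =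
      quotDet gH δ i (h'' i) := fun i => by
    rw [quotDet]
    congr 1
    funext x
    rcases x with x | x
    · exact hgqH i x
    · exact hr i x
  -- the boundaries and their lifts in the middle complex
  let b' : ∀ i, (Fin (finrank F (bdry F C d i)) ⊕ Fin (finrank F (LinearMap.range (δ i)))) ⊕
      Fin (finrank F (bdry F C'' d'' i)) → bdry F C' d' i := fun i =>
    Sum.elim (Sum.elim
      (fun j => ⟨f i (Module.finBasis F (bdry F C d i) j), S.f_mem_bdry (Subtype.prop _)⟩)
      (fun j => ⟨f i (k i j), hfkB i j⟩))
      (fun j => (d' i).rangeRestrict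
        (s (i + 1) (secB F C'' d'' i (Module.finBasis F (bdry F C'' d'' i) j))))
  let c' : ∀ i, (Fin (prevRank F C d i) ⊕ Fin (rankPrev δ i)) ⊕ Fin (prevRank F C'' d'' i) →
      C' i := fun i =>
    Sum.elim (Sum.elim (fun j => f i (thirdFam F C d i j)) (fun j => s i (r i j)))
      (fun j => s i (thirdFam F C'' d'' i j))
  let β : ℕ → F := fun i => detSq F (Module.finBasis F (bdry F C' d' i)) (b' i)
  have hβ' : ∀ i, prevDet d' (i + 1) (c' (i + 1)) = β i := fun i => by
    change detSq F _ (fun j => (d' i).rangeRestrict (c' (i + 1) j)) = detSq F _ (b' i)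
    congr 1
    funext x
    apply Subtype.ext
    rcases x with (x | x) | x
    · change d' i (f (i + 1) (secB F C d i _)) = f i _
      rw [← S.f_comm, d_secB]
    · exact (hk i x).symm
    · rfl
  have hmul : ∀ i, detSq F (e' i) (Sum.elim (fun j => (b' i j : C' i))
        (Sum.elim (fun j => (z' i j : C' i)) (c' i))) =
      (detSq F (e i) (torFam F C d h i) * exactDet (δ i) (fH i) (h i)) *
        (detSq F (e'' i) (torFam F C'' d'' h'' i) * quotDet gH δ i (h'' i)) := fun i => by
    have hc := nonempty_equiv_of_detSq_ne_zero (hz i ▸ hl i)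
    have hc'' := nonempty_equiv_of_detSq_ne_zero (hz'' i ▸ hl'' i)
    have hne := mul_ne_zero (detSq_torFam_ne_zero S.d_comp'' e'' h'' i) (hl'' i)
    rw [← hz i, ← hz'' i, ← detSq_adapted_finBasis S.d_comp e h i (z i) hc,
      ← detSq_adapted_finBasis S.d_comp'' e'' h'' i (z'' i) hc'']
    rw [← hz'' i, ← detSq_adapted_finBasis S.d_comp'' e'' h'' i (z'' i) hc''] at hne
    rw [← detSq_comp_equiv _ _ (adaptedEquiv _ _ _ _ _ _ _ _)]
    let y : Fin (finrank F (bdry F C'' d'' i)) ⊕ (Fin (finrank F (LinearMap.range (gH i))) ⊕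
        Fin (rankPrev δ i)) ⊕ Fin (prevRank F C'' d'' i) → C' i :=
      Sum.elim (fun j => b' i (Sum.inr j)) (Sum.elim (Sum.elim (fun j => q i j)
        fun j => s i (r i j)) (fun j => s i (thirdFam F C'' d'' i j)))
    have hy : (fun j => g i (y j)) =
        Sum.elim (fun j => (Module.finBasis F (bdry F C'' d'' i) j : C'' i))
          (Sum.elim (fun j => (z'' i j : C'' i)) (thirdFam F C'' d'' i)) := by
      funext x
      rcases x with x | (x | x) | x
      · change g i (d' i (s (i + 1) _)) = _
        rw [S.g_comm, hs, d_secB]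
        rfl
      · rfl
      · exact hs _ _
      · exact hs _ _
    rw [← hy] at hne ⊢
    rw [← detSq_sumElim (f := f i) (g := g i) (S.g_f i) (e i) (e'' i) (e' i) (he'f i) (he'g i) _ y
      (nonempty_equiv_of_detSq_ne_zero hne)]
    congr 1
    funext x
    rcases x with (x | (x | x) | x) | (x | (x | x) | x) <;> rfl
  have hadapt : ∀ i, Nonempty ((Fin (prevRank F C d i) ⊕ Fin (rankPrev δ i)) ⊕
      Fin (prevRank F C'' d'' i) ≃ Fin (prevRank F C' d' i)) →
      detSq F (e' i) (torFam F C' d' h' i) *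
          (β i * exactDet (fH i) (gH i) (h' i) * prevDet d' i (c' i)) =
        (detSq F (e i) (torFam F C d h i) * exactDet (δ i) (fH i) (h i)) *
          (detSq F (e'' i) (torFam F C'' d'' h'' i) * quotDet gH δ i (h'' i)) := fun i hc => by
    rw [← hmul, detSq_adapted S.d_comp' e' h' i (b' i) (z' i) (c' i)
      (nonempty_equiv_of_detSq_ne_zero (hz' i ▸ hl' i)) hc, hz']
  have hβ : ∀ i, Nonempty ((Fin (prevRank F C d i) ⊕ Fin (rankPrev δ i)) ⊕
      Fin (prevRank F C'' d'' i) ≃ Fin (prevRank F C' d' i)) → β i ≠ 0 := fun i hc h0 => by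
    have := hadapt i hc
    rw [h0, zero_mul, zero_mul, mul_zero] at this
    exact mul_ne_zero (mul_ne_zero (detSq_torFam_ne_zero S.d_comp e h i) (hl i))
      (mul_ne_zero (detSq_torFam_ne_zero S.d_comp'' e'' h'' i) (hl'' i)) this.symm
  have hc : ∀ i, Nonempty ((Fin (prevRank F C d i) ⊕ Fin (rankPrev δ i)) ⊕
      Fin (prevRank F C'' d'' i) ≃ Fin (prevRank F C' d' i)) := fun i => by
    induction i with
    | zero =>
      exact ⟨⟨fun x => Sum.elim (Sum.elim id id) id x, fun x => Fin.elim0 x,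
        fun x => by rcases x with (x | x) | x <;> exact Fin.elim0 x, fun x => Fin.elim0 x⟩⟩
    | succ i ih => exact nonempty_equiv_of_detSq_ne_zero (hβ i ih)
  refine ⟨β, fun i => prevDet d' i (c' i), fun i => hβ i (hc i), fun i _ => ?_, rfl, hβ',
    fun i => hadapt i (hc i)⟩
  have : Subsingleton (bdry F C' d' i) := by
    refine ⟨?_⟩
    rintro ⟨_, x, rfl⟩ ⟨_, y, rfl⟩
    rw [Subsingleton.elim x y]
  exact detSq_eq_one_of_subsingleton (nonempty_equiv_of_detSq_ne_zero (hβ i (hc i)))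

/-- The determinants computing the torsion of the long exact homology sequence. -/
lemma detSq_torFam_L3 (h : ∀ i, Basis (κ i) F (hml F C d i))
    (h' : ∀ i, Basis (κ' i) F (hml F C' d' i)) (h'' : ∀ i, Basis (κ'' i) F (hml F C'' d'' i)) :
    ∃ t : ℕ → F, (∀ j, t j ≠ 0) ∧ (∀ i, t (3 * i) = quotDet gH δ i (h'' i)) ∧
      (∀ i, t (3 * i + 1) = exactDet (fH i) (gH i) (h' i)) ∧
      (∀ i, t (3 * i + 2) = exactDet (δ i) (fH i) (h i)) ∧
      ∀ n, _root_.torsion F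
        (L3 (fun i => hml F C'' d'' i) (fun i => hml F C' d' i) (fun i => hml F C d i))
        (dL3 F (fun i => hml F C'' d'' i) (fun i => hml F C' d' i) (fun i => hml F C d i) gH fH δ)
        n (L3basis F (fun i => hml F C'' d'' i) (fun i => hml F C' d' i)
          (fun i => hml F C d i) κ'' κ' κ h'' h' h) ^ 2 =
        ∏ j ∈ Finset.range (n + 1), t j ^ ((-1 : ℤ) ^ (j + 1)) := by
  have hL := S.bdry_eq_cyc
  let b := L3basis F (fun i => hml F C'' d'' i) (fun i => hml F C' d' i)
    (fun i => hml F C d i) κ'' κ' κ h'' h' h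
  refine ⟨_, fun j => ?_, fun i => ?_, fun i => ?_, fun i => ?_, fun n => torsion_sq hL n b⟩
  · cases j with
    | zero => rw [detSq_torFam_zero (hL 0)]; exact detSq_torFam_zero_ne_zero hL b
    | succ j => rw [detSq_torFam_succ (hL (j + 1))]; exact exactDet_ne_zero hL b j
  · cases i with
    | zero =>
      rw [quotDet_zero]
      exact detSq_torFam_zero (hL 0) b
    | succ i =>
      exact (detSq_torFam_succ (hL (3 * i + 3)) b).trans
        (exactDet_dL3_three _ _ _ gH fH δ κ'' κ' κ h'' h' h i)
  · exact (detSq_torFam_succ (hL (3 * i + 1)) b).trans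
      (exactDet_dL3_one _ _ _ gH fH δ κ'' κ' κ h'' h' h i)
  · exact (detSq_torFam_succ (hL (3 * i + 2)) b).trans
      (exactDet_dL3_two _ _ _ gH fH δ κ'' κ' κ h'' h' h i)

end IsHomologySequence

end HomologySequence

section AlternatingProduct

lemma prod_range_three_mul (t : ℕ → F) (n : ℕ) :
    ∏ j ∈ Finset.range (3 * n), t j =
      ∏ i ∈ Finset.range n, (t (3 * i) * t (3 * i + 1) * t (3 * i + 2)) := by
  induction n with
  | zero => rfl
  | succ n ih =>
    rw [show 3 * (n + 1) = 3 * n + 1 + 1 + 1 by ring, Finset.prod_range_succ,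
      Finset.prod_range_succ, Finset.prod_range_succ, ih, Finset.prod_range_succ]
    ring

lemma prod_zpow_alternating {β β' : ℕ → F} (hβ : ∀ i, β i ≠ 0) (hβ₀ : β' 0 = 1)
    (hβ' : ∀ i, β' (i + 1) = β i) (n : ℕ) :
    ∏ i ∈ Finset.range (n + 1), (β i * β' i) ^ ((-1 : ℤ) ^ (i + 1)) =
      β n ^ ((-1 : ℤ) ^ (n + 1)) := by
  induction n with
  | zero => simp [hβ₀]
  | succ n ih =>
    rw [Finset.prod_range_succ, ih, hβ', mul_zpow, pow_succ (-1 : ℤ) (n + 1), mul_neg_one,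
      mul_comm, mul_assoc, ← zpow_add₀ (hβ n), neg_add_cancel, zpow_zero, mul_one]

end AlternatingProduct

/-- Let `0 → C_* → C'_* → C''_* → 0` (with maps `f : C → C'` and `g : C' → C''`) be a short
exact sequence of finite chain complexes of finite-dimensional `F`-vector spaces concentrated
in degrees `0, …, n`.  Let `e, e', e''` be ordered bases compatible with the exact sequence:
`e'_i` is indexed by `ι_i ⊕ ι''_i`, consists of the image under `f` of `e_i` together with a
lift under `g` of `e''_i`.  Let `h, h', h''` be ordered bases of the homology `H_*(C)`,
`H_*(C')`, `H_*(C'')`.  Let `L_*` be the long exact homology sequence, regarded as a chain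
complex (`L_{3i} = H_i(C'')`, `L_{3i+1} = H_i(C')`, `L_{3i+2} = H_i(C)`, with differentials the
induced maps `g_*`, `f_*` and the connecting homomorphism `δ`, characterized by the usual
formulas below), with basis `b` obtained by combining `h, h', h''`.  Then the Reidemeister
torsions satisfy `τ̂(C', e', h') = ± τ̂(C, e, h) · τ̂(C'', e'', h'') · τ(L_*, b)`. -/
theorem torsionHat_mul_of_short_exact
    (C C' C'' : ℕ → Type)
    [∀ i, AddCommGroup (C i)] [∀ i, Module F (C i)] [∀ i, FiniteDimensional F (C i)]
    [∀ i, AddCommGroup (C' i)] [∀ i, Module F (C' i)] [∀ i, FiniteDimensional F (C' i)]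
    [∀ i, AddCommGroup (C'' i)] [∀ i, Module F (C'' i)] [∀ i, FiniteDimensional F (C'' i)]
    (d : ∀ i, C (i + 1) →ₗ[F] C i) (d' : ∀ i, C' (i + 1) →ₗ[F] C' i)
    (d'' : ∀ i, C'' (i + 1) →ₗ[F] C'' i)
    (hd : ∀ i, (d i).comp (d (i + 1)) = 0) (hd' : ∀ i, (d' i).comp (d' (i + 1)) = 0)
    (hd'' : ∀ i, (d'' i).comp (d'' (i + 1)) = 0)
    (n : ℕ) (htriv : ∀ i, n < i → Subsingleton (C i)) (htriv' : ∀ i, n < i → Subsingleton (C' i))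
    (htriv'' : ∀ i, n < i → Subsingleton (C'' i))
    -- the short exact sequence of chain complexes
    (f : ∀ i, C i →ₗ[F] C' i) (g : ∀ i, C' i →ₗ[F] C'' i)
    (hfchain : ∀ i, (f i).comp (d i) = (d' i).comp (f (i + 1)))
    (hgchain : ∀ i, (g i).comp (d' i) = (d'' i).comp (g (i + 1)))
    (hfinj : ∀ i, Function.Injective ⇑(f i)) (hgsurj : ∀ i, Function.Surjective ⇑(g i))
    (hfg : ∀ i, LinearMap.range (f i) = LinearMap.ker (g i))
    -- compatible bases of the chain groups
    (ι ι'' : ℕ → Type) [∀ i, Fintype (ι i)] [∀ i, Fintype (ι'' i)]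
    (e : ∀ i, Basis (ι i) F (C i)) (e'' : ∀ i, Basis (ι'' i) F (C'' i))
    (e' : ∀ i, Basis (ι i ⊕ ι'' i) F (C' i))
    (he'f : ∀ i (j : ι i), e' i (Sum.inl j) = f i (e i j))
    (he'g : ∀ i (k : ι'' i), g i (e' i (Sum.inr k)) = e'' i k)
    -- bases of the homology
    (κ κ' κ'' : ℕ → Type) [∀ i, Fintype (κ i)] [∀ i, Fintype (κ' i)] [∀ i, Fintype (κ'' i)]
    (h : ∀ i, Basis (κ i) F (hml F C d i)) (h' : ∀ i, Basis (κ' i) F (hml F C' d' i))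
    (h'' : ∀ i, Basis (κ'' i) F (hml F C'' d'' i))
    -- the maps of the long exact homology sequence, with their characterizing properties
    (fH : ∀ i, hml F C d i →ₗ[F] hml F C' d' i)
    (hfH : ∀ i (z : ↥(cyc F C d i)) (hz : f i z.val ∈ cyc F C' d' i),
      fH i (Submodule.Quotient.mk z) = Submodule.Quotient.mk ⟨f i z.val, hz⟩)
    (gH : ∀ i, hml F C' d' i →ₗ[F] hml F C'' d'' i)
    (hgH : ∀ i (z : ↥(cyc F C' d' i)) (hz : g i z.val ∈ cyc F C'' d'' i),
      gH i (Submodule.Quotient.mk z) = Submodule.Quotient.mk ⟨g i z.val, hz⟩)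
    (δ : ∀ i, hml F C'' d'' (i + 1) →ₗ[F] hml F C d i)
    (hδ : ∀ i (c1 : C' (i + 1)) (hgc : g (i + 1) c1 ∈ cyc F C'' d'' (i + 1))
      (a : C i) (ha : f i a = d' i c1) (haz : a ∈ cyc F C d i),
      δ i (Submodule.Quotient.mk ⟨g (i + 1) c1, hgc⟩) = Submodule.Quotient.mk ⟨a, haz⟩) :
    -- conclusion: the product formula for Reidemeister torsion
    torsionHat F C' d' n e' h' =
        torsionHat F C d n e h * torsionHat F C'' d'' n e'' h'' *
          torsion F
            (L3 (fun i => hml F C'' d'' i) (fun i => hml F C' d' i) (fun i => hml F C d i))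
            (dL3 F (fun i => hml F C'' d'' i) (fun i => hml F C' d' i) (fun i => hml F C d i)
              gH fH δ)
            (3 * n + 2)
            (L3basis F (fun i => hml F C'' d'' i) (fun i => hml F C' d' i)
              (fun i => hml F C d i) κ'' κ' κ h'' h' h) ∨
      torsionHat F C' d' n e' h' =
        -(torsionHat F C d n e h * torsionHat F C'' d'' n e'' h'' *
          torsion F
            (L3 (fun i => hml F C'' d'' i) (fun i => hml F C' d' i) (fun i => hml F C d i))
            (dL3 F (fun i => hml F C'' d'' i) (fun i => hml F C' d' i) (fun i => hml F C d i)
              gH fH δ)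
            (3 * n + 2)
            (L3basis F (fun i => hml F C'' d'' i) (fun i => hml F C' d' i)
              (fun i => hml F C d i) κ'' κ' κ h'' h' h)) := by
  have S : IsHomologySequence d d' d'' f g fH gH δ :=
    ⟨hd, hd', hd'', fun i => LinearMap.congr_fun (hfchain i),
      fun i => LinearMap.congr_fun (hgchain i), hfinj, hgsurj, hfg, hfH, hgH, hδ⟩
  obtain ⟨t, ht, ht₀, ht₁, ht₂, htor⟩ := S.detSq_torFam_L3 h h' h''
  obtain ⟨β, β', hβ, hβn, hβ₀, hβ', heq⟩ := S.exists_detSq_mul_eq e e'' e' he'f he'g h h' h''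
    (fun i => ht₂ i ▸ ht _) (fun i => ht₁ i ▸ ht _) (fun i => ht₀ i ▸ ht _)
  rw [← sq_eq_sq_iff_eq_or_eq_neg, mul_pow, mul_pow, htor, torsionHat_sq, torsionHat_sq,
    torsionHat_sq, show 3 * n + 2 + 1 = 3 * (n + 1) by ring, prod_range_three_mul]
  have hone := prod_zpow_alternating F hβ hβ₀ hβ' n
  rw [hβn n (htriv' (n + 1) n.lt_succ_self), one_zpow] at hone
  rw [← mul_one (∏ i ∈ Finset.range (n + 1), detSq F (e' i) (torFam F C' d' h' i) ^ _), ← hone,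
    ← Finset.prod_mul_distrib, ← Finset.prod_mul_distrib, ← Finset.prod_mul_distrib]
  refine Finset.prod_congr rfl fun i _ => ?_
  have h1 : (-1 : ℤ) ^ (3 * i + 1) = (-1) ^ (i + 1) := by
    rw [show 3 * i + 1 = 2 * i + (i + 1) by ring, pow_add, pow_mul]
    simp
  rw [pow_succ _ (3 * i + 1 + 1), pow_succ _ (3 * i + 1), h1, mul_neg_one, mul_neg_one, neg_neg, zpow_neg,
    ← inv_zpow, ← mul_zpow, ← mul_zpow, ← mul_zpow, ← mul_zpow, ← mul_zpow]
  congr 1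
  have hi := heq i
  rw [← ht₀, ← ht₁, ← ht₂] at hi
  have := ht (3 * i + 1)
  field_simp
  linear_combination hi

end
end

section
/- Let F be a field and t ∈ F. For i = 0, ..., n let D_i and E_i be finite-dimensional F-vector spaces (with E_{-1} = 0 and E_n = 0), each equipped with a fixed ordered basis, and set C_i := D_i ⊕ E_i ⊕ E_{i-1}, with the induced basis e. Suppose ∂_i : C_i → C_{i-1} is given in block form by ∂_i(d, x, y) = ( N_i d + W_i y , -t M_i d + ∂^Σ_i x + (1 - tφ_{i-1}) y , -∂^Σ_{i-1} y ), for linear maps N_i : D_i → D_{i-1}, M_i : D_i → E_{i-1}, W_i : E_{i-1} → D_{i-1}, ∂^Σ_i : E_i → E_{i-1}, and φ_{i-1} : E_{i-1} → E_{i-1}. Assume: (i) ∂_{i-1} ∘ ∂_i = 0 for all i, so (C_*, ∂) is a chain complex; (ii) (C_*, ∂) is acyclic; (iii) each 1 - tφ_{i-1} is invertible; and (iv) there are decompositions D_i = D_i^A ⊕ D_i^B into spans of subsets of the chosen basis of D_i such that, setting K_i := N_i + t W_i (1 - tφ_{i-1})^{-1} M_i : D_i → D_{i-1}, the map π_{D_{i-1}^B}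 ∘ K_i|_{D_i^A} : D_i^A → D_{i-1}^B is an isomorphism for every i. Then the Reidemeister torsion satisfies τ(C_*, e) = ± ∏_{i=1}^n ( det(1 - tφ_{i-1}) · det( π_{D_{i-1}^B} ∘ K_i|_{D_i^A} ) )^{(-1)^i}, where the determinants are computed in the chosen bases and subbases. -/
open Module Submodule

noncomputable section

variable (F : Type) [Field F]

section Block

variable (t : F) (D E : ℕ → Type) [∀ i, AddCommGroup (D i)] [∀ i, Module F (D i)]
  [∀ i, FiniteDimensional F (D i)] [∀ i, AddCommGroup (E i)] [∀ i, Module F (E i)]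
  [∀ i, FiniteDimensional F (E i)]

/-- The spaces `C_i := D_i ⊕ E_i ⊕ E_{i-1}` (with `E_{-1} = 0` realized as the zero vector
space `Fin 0 → F`). -/
def blkC : ℕ → Type
  | 0 => D 0 × E 0 × (Fin 0 → F)
  | (i + 1) => D (i + 1) × E (i + 1) × E i

instance : ∀ i, AddCommGroup (blkC F D E i)
  | 0 => inferInstanceAs (AddCommGroup (D 0 × E 0 × (Fin 0 → F)))
  | (i + 1) => inferInstanceAs (AddCommGroup (D (i + 1) × E (i + 1) × E i))

instance : ∀ i, Module F (blkC F D E i)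
  | 0 => inferInstanceAs (Module F (D 0 × E 0 × (Fin 0 → F)))
  | (i + 1) => inferInstanceAs (Module F (D (i + 1) × E (i + 1) × E i))

instance : ∀ i, FiniteDimensional F (blkC F D E i)
  | 0 => inferInstanceAs (FiniteDimensional F (D 0 × E 0 × (Fin 0 → F)))
  | (i + 1) => inferInstanceAs (FiniteDimensional F (D (i + 1) × E (i + 1) × E i))

variable (N : ∀ i, D (i + 1) →ₗ[F] D i) (M : ∀ i, D (i + 1) →ₗ[F] E i)
  (W : ∀ i, E i →ₗ[F] D i) (dS : ∀ i, E (i + 1) →ₗ[F] E i) (φ : ∀ i, E i →ₗ[F] E i)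

/-- The block-form differential
`∂_i(d, x, y) = (N_i d + W_i y, -t M_i d + ∂^Σ_i x + (1 - tφ_{i-1}) y, -∂^Σ_{i-1} y)`
(for a chain `(d, x, y) ∈ C_i = D_i ⊕ E_i ⊕ E_{i-1}`, with the last component landing in
`E_{i-2}`, which is `0` when `i ≤ 1`). -/
def blkD : ∀ i, blkC F D E (i + 1) →ₗ[F] blkC F D E i
  | 0 =>
      ((N 0).comp (LinearMap.fst F (D 1) (E 1 × E 0)) +
        (W 0).comp ((LinearMap.snd F (E 1) (E 0)).comp
          (LinearMap.snd F (D 1) (E 1 × E 0)))).prod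
      ((((-t) • M 0).comp (LinearMap.fst F (D 1) (E 1 × E 0)) +
          (dS 0).comp ((LinearMap.fst F (E 1) (E 0)).comp
            (LinearMap.snd F (D 1) (E 1 × E 0))) +
          (((LinearMap.snd F (E 1) (E 0)).comp (LinearMap.snd F (D 1) (E 1 × E 0))) -
            t • ((φ 0).comp ((LinearMap.snd F (E 1) (E 0)).comp
              (LinearMap.snd F (D 1) (E 1 × E 0)))))).prod 0)
  | (i + 1) =>
      ((N (i + 1)).comp (LinearMap.fst F (D (i + 2)) (E (i + 2) × E (i + 1))) +
        (W (i + 1)).comp ((LinearMap.snd F (E (i + 2)) (E (i + 1))).comp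
          (LinearMap.snd F (D (i + 2)) (E (i + 2) × E (i + 1))))).prod
      ((((-t) • M (i + 1)).comp (LinearMap.fst F (D (i + 2)) (E (i + 2) × E (i + 1))) +
          (dS (i + 1)).comp ((LinearMap.fst F (E (i + 2)) (E (i + 1))).comp
            (LinearMap.snd F (D (i + 2)) (E (i + 2) × E (i + 1)))) +
          (((LinearMap.snd F (E (i + 2)) (E (i + 1))).comp
              (LinearMap.snd F (D (i + 2)) (E (i + 2) × E (i + 1)))) -
            t • ((φ (i + 1)).comp ((LinearMap.snd F (E (i + 2)) (E (i + 1))).comp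
              (LinearMap.snd F (D (i + 2)) (E (i + 2) × E (i + 1))))))).prod
      ((-(dS i)).comp ((LinearMap.snd F (E (i + 2)) (E (i + 1))).comp
        (LinearMap.snd F (D (i + 2)) (E (i + 2) × E (i + 1))))))

variable {ιD ιE : ℕ → Type} [∀ i, Fintype (ιD i)] [∀ i, Fintype (ιE i)]

/-- The index types for the induced basis of `C_i = D_i ⊕ E_i ⊕ E_{i-1}`. -/
def blkIdx : ℕ → Type
  | 0 => ιD 0 ⊕ ιE 0 ⊕ Fin 0
  | (i + 1) => ιD (i + 1) ⊕ ιE (i + 1) ⊕ ιE i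

instance : ∀ i, Fintype (blkIdx (ιD := ιD) (ιE := ιE) i)
  | 0 => inferInstanceAs (Fintype (ιD 0 ⊕ ιE 0 ⊕ Fin 0))
  | (i + 1) => inferInstanceAs (Fintype (ιD (i + 1) ⊕ ιE (i + 1) ⊕ ιE i))

/-- The basis of `C_i = D_i ⊕ E_i ⊕ E_{i-1}` induced by the fixed ordered bases of the `D_i`
and `E_i`. -/
def blkBasis (bD : ∀ i, Basis (ιD i) F (D i)) (bE : ∀ i, Basis (ιE i) F (E i)) :
    ∀ i, Basis (blkIdx (ιD := ιD) (ιE := ιE) i) F (blkC F D E i)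
  | 0 => (bD 0).prod ((bE 0).prod (Pi.basisFun F (Fin 0)))
  | (i + 1) => (bD (i + 1)).prod ((bE (i + 1)).prod (bE i))

/-- The map `K_i := N_i + t W_i (1 - tφ_{i-1})⁻¹ M_i : D_i → D_{i-1}`. -/
def blkK (hinv : ∀ i, Function.Bijective ⇑((LinearMap.id : E i →ₗ[F] E i) - t • φ i))
    (i : ℕ) : D (i + 1) →ₗ[F] D i :=
  N i + t • ((W i).comp
    (((LinearEquiv.ofBijective ((LinearMap.id : E i →ₗ[F] E i) - t • φ i)
      (hinv i)).symm.toLinearMap).comp (M i)))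

/-- The composition `π_{D_{i-1}^B} ∘ K_i|_{D_i^A} : D_i^A → D_{i-1}^B`, where
`D_i^A = span(bD_i(SA_i))` and `D_i^B = span(bD_i(SB_i))` form a direct sum decomposition of
`D_i`, and `π_{D_i^B}` is the projection onto `D_i^B` along `D_i^A`. -/
def blkProjK (bD : ∀ i, Basis (ιD i) F (D i)) (SA SB : ∀ i, Finset (ιD i))
    (hcompl : ∀ i, IsCompl (span F (⇑(bD i) '' ↑(SA i))) (span F (⇑(bD i) '' ↑(SB i))))
    (hinv : ∀ i, Function.Bijective ⇑((LinearMap.id : E i →ₗ[F] E i) - t • φ i))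
    (i : ℕ) :
    ↥(span F (⇑(bD (i + 1)) '' ↑(SA (i + 1)))) →ₗ[F] ↥(span F (⇑(bD i) '' ↑(SB i))) :=
  (Submodule.linearProjOfIsCompl (span F (⇑(bD i) '' ↑(SB i))) (span F (⇑(bD i) '' ↑(SA i)))
      (hcompl i).symm).comp
    ((blkK F t D E N M W φ hinv i).comp (span F (⇑(bD (i + 1)) '' ↑(SA (i + 1)))).subtype)

end Block

/-- The determinant of a finite family agrees, up to sign, with the determinant computed after any
relabelling of the index types. -/
theorem detFam_sq_s6 {V ι κ μ : Type} [AddCommGroup V] [Module F V] [Fintype ι] [Fintype κ]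
    [Fintype μ] [DecidableEq μ] (e : Basis ι F V) (v : κ → V) (s : μ ≃ ι) (σ : μ ≃ κ) :
    detFam F e v ^ 2 = (e.reindex s.symm).det (v ∘ σ) ^ 2 := by
  classical
  have hc : Nonempty (κ ≃ ι) := ⟨σ.symm.trans s⟩
  unfold detFam
  rw [dif_pos hc, Basis.det_reindex]
  have hperm : (v ∘ σ) ∘ s.symm = (v ∘ (Classical.choice hc).symm) ∘
      ((s.symm.trans σ).trans (Classical.choice hc) : Equiv.Perm ι) := by
    ext x; simp
  rw [hperm, AlternatingMap.map_perm]
  rcases Int.units_eq_one_or (Equiv.Perm.sign ((s.symm.trans σ).trans (Classical.choice hc)))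
    with h | h <;> rw [h] <;> simp

section Abstract

variable {V γ α : Type} [AddCommGroup V] [Module F V] [DecidableEq γ] [DecidableEq α]

/-- The matrix of a basis whose first half has been replaced by the family `a`. -/
theorem toMatrix_sumElim_inr (g : Basis (γ ⊕ α) F V) (a : γ → V) :
    g.toMatrix (Sum.elim a (g ∘ Sum.inr)) =
      Matrix.fromBlocks (.of fun k j => g.repr (a j) (Sum.inl k)) 0
        (.of fun k j => g.repr (a j) (Sum.inr k)) 1 := by
  ext (i | i) (j | j) <;>
    simp [Basis.toMatrix_apply, Finsupp.single_apply, Matrix.one_apply, eq_comm]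

variable [Fintype γ] [Fintype α]

/-- The determinant of a family which is block triangular with respect to `Sum.elim a (g ∘ inr)`. -/
theorem det_sumElim_triangular (g : Basis (γ ⊕ α) F V) (a b : γ → V) (l : α → V)
    (P : Matrix γ γ F) (Q : Matrix α α F) (R : Matrix γ α F)
    (hb : ∀ j, b j = ∑ k, P k j • a k)
    (hl : ∀ j, l j = ∑ k, R k j • a k + ∑ k, Q k j • g (Sum.inr k)) :
    g.det (Sum.elim b l) =
      (Matrix.of fun k j => g.repr (a j) (Sum.inl k)).det * (P.det * Q.det) := by
  have hmul : g.toMatrix (Sum.elim b l) =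
      g.toMatrix (Sum.elim a (g ∘ Sum.inr)) * Matrix.fromBlocks P R 0 Q := by
    ext i (j | j)
    · simp [Basis.toMatrix_apply, Matrix.mul_apply, hb, mul_comm]
    · simp [Basis.toMatrix_apply, Matrix.mul_apply, hl, mul_comm, -Basis.repr_self]
  rw [Basis.det_apply, hmul, Matrix.det_mul, toMatrix_sumElim_inr, Matrix.det_fromBlocks_zero₁₂,
    Matrix.det_fromBlocks_zero₂₁, Matrix.det_one, mul_one]

theorem sumElim_linearIndependent_and_span (g : Basis (γ ⊕ α) F V) (a : γ → V)
    (ha : (Matrix.of fun k j => g.repr (a j) (Sum.inl k)).det ≠ 0) :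
    LinearIndependent F (Sum.elim a (g ∘ Sum.inr)) ∧
      span F (Set.range (Sum.elim a (g ∘ Sum.inr))) = ⊤ := by
  rw [Basis.is_basis_iff_det g, Basis.det_apply, toMatrix_sumElim_inr,
    Matrix.det_fromBlocks_zero₁₂, Matrix.det_one, mul_one]
  exact ha.isUnit

end Abstract

theorem prod_range_succ_mul_zpow_neg_one (q : ℕ → F) (hq : ∀ i, q i ≠ 0) (h0 : q 0 = 1) (m : ℕ) :
    ∏ i ∈ Finset.range m, (q (i + 1) * q i) ^ ((-1 : ℤ) ^ (i + 1)) = q m ^ ((-1 : ℤ) ^ m) := by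
  induction m with
  | zero => simp [h0]
  | succ m ih =>
    rw [Finset.prod_range_succ, ih, mul_zpow, mul_comm (q (m + 1) ^ _), ← mul_assoc,
      ← zpow_add₀ (hq m), pow_succ]
    simp

section TorsionChain

variable (C : ℕ → Type) [∀ i, AddCommGroup (C i)] [∀ i, Module F (C i)]
  (d : ∀ i, C (i + 1) →ₗ[F] C i)
  {α : ℕ → Type} [∀ i, Fintype (α i)] [∀ i, DecidableEq (α i)]
  (g : ∀ i, Basis (α (i + 1) ⊕ α i) F (C i))

/-- The square block of `∂ : C_{i+1} → C_i` selected by a chain of index sets: its columns are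
indexed by the second part of the basis of `C_{i+1}`, its rows by the first part of the basis of
`C_i`. -/
def chainBlock (i : ℕ) : Matrix (α (i + 1)) (α (i + 1)) F :=
  .of fun k j => (g i).repr (d i (g (i + 1) (Sum.inr j))) (Sum.inl k)

variable {C d g}

/-- The boundaries of the selected basis vectors form a basis of the space of boundaries. -/
theorem exists_basis_bdry [IsEmpty (α 0)] (hex : ∀ i, bdry F C d i = cyc F C d i)
    (hX : ∀ i, (chainBlock F C d g i).det ≠ 0) (i : ℕ) :
    ∃ a : Basis (α (i + 1)) F (bdry F C d i), ∀ k, (a k : C i) = d i (g (i + 1) (Sum.inr k)) := by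
  have hli (i : ℕ) := sumElim_linearIndependent_and_span F (g i)
    (fun k => d i (g (i + 1) (Sum.inr k))) (hX i)
  have hli' (i : ℕ) : LinearIndependent F (fun k => d i (g (i + 1) (Sum.inr k))) :=
    (hli i).1.comp Sum.inl Sum.inl_injective
  let a : α (i + 1) → bdry F C d i := fun k => ⟨d i (g (i + 1) (Sum.inr k)), ⟨_, rfl⟩⟩
  have ha : LinearIndependent F a := .of_comp (bdry F C d i).subtype (hli' i)
  suffices hsp : ⊤ ≤ span F (Set.range a) from ⟨Basis.mk ha hsp, fun k => by simp [a]⟩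
  rintro ⟨z, hz⟩ -
  have hzt : z ∈ span F (Set.range (Sum.elim (fun k => d i (g (i + 1) (Sum.inr k)))
    (g i ∘ Sum.inr))) := by rw [(hli i).2]; trivial
  obtain ⟨c, rfl⟩ := (Submodule.mem_span_range_iff_exists_fun F).1 hzt
  have hc : ∀ k, c (Sum.inr k) = 0 := by
    cases i with
    | zero => exact fun k => isEmptyElim k
    | succ i =>
      have hz' := hz
      rw [hex] at hz'
      have hdd (x : C (i + 2)) : d i (d (i + 1) x) = 0 := by
        have hx : d (i + 1) x ∈ cyc F C d (i + 1) := by rw [← hex]; exact ⟨x, rfl⟩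
        exact hx
      change d i _ = 0 at hz'
      simp only [Fintype.sum_sum_type, Sum.elim_inl, Sum.elim_inr, map_add, map_sum, map_smul, hdd,
        smul_zero, Finset.sum_const_zero, zero_add, Function.comp_apply] at hz'
      exact Fintype.linearIndependent_iff.1 (hli' i) _ hz'
  refine (Submodule.mem_span_range_iff_exists_fun F).2 ⟨fun k => c (Sum.inl k), Subtype.ext ?_⟩
  simp [a, Fintype.sum_sum_type, hc]

variable {n : ℕ} {ι κ : ℕ → Type} [∀ i, Fintype (ι i)] [∀ i, Fintype (κ i)]

/-- The torsion of an acyclic complex is, up to sign, the alternating product of the determinants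
of a chain of invertible blocks of its differentials. -/
theorem sq_torsionHat_eq_prod_det_chainBlock [∀ i, FiniteDimensional F (C i)] [IsEmpty (α 0)]
    [IsEmpty (α (n + 1))] [∀ i, IsEmpty (κ i)] (e : ∀ i, Basis (ι i) F (C i))
    (s : ∀ i, α (i + 1) ⊕ α i ≃ ι i)
    (hg : ∀ i, g i = (e i).reindex (s i).symm) (h : ∀ i, Basis (κ i) F (hml F C d i))
    (hex : ∀ i, bdry F C d i = cyc F C d i) (hX : ∀ i, (chainBlock F C d g i).det ≠ 0) :
    torsionHat F C d n e h ^ 2 =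
      (∏ i ∈ Finset.range n, (chainBlock F C d g i).det ^ ((-1 : ℤ) ^ (i + 1))) ^ 2 := by
  choose a ha using exists_basis_bdry F hex hX
  let ρ (i : ℕ) : α (i + 1) ≃ Fin (finrank F (bdry F C d i)) :=
    (a i).indexEquiv (Module.finBasis F (bdry F C d i))
  let P (i : ℕ) : Matrix (α (i + 1)) (α (i + 1)) F :=
    (a i).toMatrix (Module.finBasis F (bdry F C d i) ∘ ρ i)
  have hP (i : ℕ) : (P i).det ≠ 0 := by
    have h := (a i).isUnit_det ((Module.finBasis F (bdry F C d i)).reindex (ρ i).symm)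
    rw [Basis.coe_reindex, Equiv.symm_symm] at h
    exact h.ne_zero
  let q : ℕ → F := fun i => i.casesOn 1 fun i => (P i).det
  have hq_zero : q 0 = 1 := rfl
  have hq_succ (i : ℕ) : q (i + 1) = (P i).det := rfl
  have hq : ∀ i, q i ≠ 0 := by rintro (_ | i); exacts [one_ne_zero, hP i]
  have hb (i : ℕ) (j : α (i + 1)) : ((Module.finBasis F (bdry F C d i) (ρ i j) : _) : C i) =
      ∑ k, P i k j • d i (g (i + 1) (Sum.inr k)) := by
    have hs := congrArg (bdry F C d i).subtype
      ((a i).sum_repr (Module.finBasis F (bdry F C d i) (ρ i j)))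
    simp only [map_sum, map_smul, Submodule.subtype_apply, ha] at hs
    exact hs.symm
  have key (i : ℕ) : detFam F (e i) (torFam F C d h i) ^ 2 =
      ((q (i + 1) * q i) * (chainBlock F C d g i).det) ^ 2 := by
    cases i with
    | zero =>
      let σ : α 1 ⊕ α 0 ≃ Fin (finrank F (bdry F C d 0)) ⊕ κ 0 ⊕ Fin (prevRank F C d 0) :=
        Equiv.sumCongr (ρ 0) (@Equiv.equivOfIsEmpty _ _ _ (inferInstanceAs (IsEmpty (κ 0 ⊕ Fin 0))))
      rw [detFam_sq_s6 F _ _ (s 0) σ, ← hg]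
      have hfam : torFam F C d h 0 ∘ σ = Sum.elim
          (fun j => ((Module.finBasis F (bdry F C d 0) (ρ 0 j) : _) : C 0)) isEmptyElim := by
        ext (j | j)
        · rfl
        · exact isEmptyElim j
      rw [hfam, det_sumElim_triangular F (g 0) _ _ _ (P 0) 1 0 (hb 0) (fun j => isEmptyElim j)]
      rw [hq_zero, hq_succ, Matrix.det_one, chainBlock]
      ring
    | succ i =>
      let σ : α (i + 2) ⊕ α (i + 1) ≃ Fin (finrank F (bdry F C d (i + 1))) ⊕ κ (i + 1) ⊕
          Fin (prevRank F C d (i + 1)) :=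
        Equiv.sumCongr (ρ (i + 1)) ((ρ i).trans (Equiv.emptySum _ _).symm)
      rw [detFam_sq_s6 F _ _ (s (i + 1)) σ, ← hg]
      let l (j : α (i + 1)) : C (i + 1) :=
        secB F C d i (Module.finBasis F (bdry F C d i) (ρ i j))
      have hfam : torFam F C d h (i + 1) ∘ σ = Sum.elim (fun j =>
          ((Module.finBasis F (bdry F C d (i + 1)) (ρ (i + 1) j) : _) : C (i + 1))) l := by
        ext (j | j) <;> rfl
      have hsec (x : bdry F C d i) : d i (secB F C d i x) = x := by
        have hx := ((d i).rangeRestrict.exists_rightInverse_of_surjective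
          (LinearMap.range_eq_top.mpr (d i).surjective_rangeRestrict)).choose_spec
        exact congrArg Subtype.val (LinearMap.congr_fun hx x)
      have hmem (j : α (i + 1)) :
          l j - ∑ k, P i k j • g (i + 1) (Sum.inr k) ∈ bdry F C d (i + 1) := by
        rw [hex]
        change d i _ = 0
        simp only [map_sub, l, hsec, hb, map_sum, map_smul, sub_self]
      have hl (j : α (i + 1)) : l j = ∑ k, (a (i + 1)).repr ⟨_, hmem j⟩ k •
          d (i + 1) (g (i + 2) (Sum.inr k)) + ∑ k, P i k j • g (i + 1) (Sum.inr k) := by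
        rw [← sub_eq_iff_eq_add]
        have hs := congrArg (bdry F C d (i + 1)).subtype ((a (i + 1)).sum_repr ⟨_, hmem j⟩)
        simp only [map_sum, map_smul, Submodule.subtype_apply, ha] at hs
        exact hs.symm
      rw [hfam, det_sumElim_triangular F (g (i + 1)) _ _ _ (P (i + 1)) (P i)
        (.of fun k j => (a (i + 1)).repr ⟨_, hmem j⟩ k) (hb (i + 1)) hl]
      rw [hq_succ, hq_succ, chainBlock]
      ring
  have hqn : q (n + 1) = 1 := Matrix.det_isEmpty
  have hXn : (chainBlock F C d g n).det = 1 := Matrix.det_isEmpty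
  unfold torsionHat
  rw [← Finset.prod_pow]
  simp only [← zpow_natCast, ← zpow_mul, mul_comm _ ((2 : ℕ) : ℤ)]
  simp only [zpow_mul, zpow_natCast, key]
  simp only [← zpow_natCast, ← zpow_mul, mul_comm ((2 : ℕ) : ℤ)]
  simp only [zpow_mul, zpow_natCast]
  rw [Finset.prod_pow]
  simp only [mul_zpow (q _ * q _), Finset.prod_mul_distrib]
  rw [prod_range_succ_mul_zpow_neg_one F q hq rfl, hqn, Finset.prod_range_succ, hXn]
  simp

end TorsionChain

section SubBasis

variable {V ι : Type} [AddCommGroup V] [Module F V]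

theorem coe_subBasis (e : Basis ι F V) (S : Finset ι) (j : {j // j ∈ S}) :
    (subBasis F e S j : V) = e j := by
  simp [subBasis, Basis.span_apply]

theorem mem_iff_notMem_of_isCompl_span (e : Basis ι F V) {S T : Finset ι}
    (h : IsCompl (span F (e '' ↑S)) (span F (e '' ↑T))) (j : ι) : j ∈ T ↔ j ∉ S := by
  constructor
  · intro hT hS
    exact e.ne_zero j (Submodule.disjoint_def.1 h.disjoint _ (subset_span ⟨j, hS, rfl⟩)
      (subset_span ⟨j, hT, rfl⟩))
  · intro hS
    have hj : e j ∈ span F (e '' (↑S ∪ ↑T : Set ι)) := by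
      rw [Set.image_union, span_union, h.sup_eq_top]
      trivial
    rw [Basis.mem_span_image, e.repr_self, Finsupp.support_single] at hj
    · simpa [hS] using hj
    · exact one_ne_zero

theorem subBasis_repr_projectionOnto (e : Basis ι F V) {S T : Finset ι}
    (h : IsCompl (span F (e '' ↑T)) (span F (e '' ↑S))) (x : V) (k : {k // k ∈ T}) :
    (subBasis F e T).repr (Submodule.projectionOnto _ _ h x) k = e.repr x k := by
  classical
  suffices hlin : ((subBasis F e T).coord k).comp (Submodule.projectionOnto _ _ h) = e.coord k from
    LinearMap.congr_fun hlin x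
  refine e.ext fun j => ?_
  by_cases hj : j ∈ T
  · have hp : Submodule.projectionOnto _ _ h (e j) = subBasis F e T ⟨j, hj⟩ := by
      rw [← Submodule.projectionOnto_apply_left h (subBasis F e T ⟨j, hj⟩), coe_subBasis]
    simp [hp, Finsupp.single_apply, Subtype.ext_iff]
  · have hS : j ∈ S := (mem_iff_notMem_of_isCompl_span F e h j).2 hj
    have hp : Submodule.projectionOnto _ _ h (e j) = 0 :=
      Submodule.projectionOnto_apply_right h ⟨e j, subset_span ⟨j, hS, rfl⟩⟩
    have hne : j ≠ k := fun hjk => hj (hjk ▸ k.2)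
    simp [hp, hne]

end SubBasis

section BlockBasis

variable {ιD ιE : ℕ → Type} (SA : ∀ i, Finset (ιD i))

/-- The indices of the basis of `D_i^A ⊕ E_{i-1}`. -/
def selIdx (ιE : ℕ → Type) : ℕ → Type
  | 0 => {j // j ∈ SA 0} ⊕ Fin 0
  | (i + 1) => {j // j ∈ SA (i + 1)} ⊕ ιE i

instance [∀ i, Fintype (ιE i)] : ∀ i, Fintype (selIdx SA ιE i)
  | 0 => inferInstanceAs (Fintype ({j // j ∈ SA 0} ⊕ Fin 0))
  | (i + 1) => inferInstanceAs (Fintype ({j // j ∈ SA (i + 1)} ⊕ ιE i))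

instance [∀ i, DecidableEq (ιD i)] [∀ i, DecidableEq (ιE i)] : ∀ i, DecidableEq (selIdx SA ιE i)
  | 0 => inferInstanceAs (DecidableEq ({j // j ∈ SA 0} ⊕ Fin 0))
  | (i + 1) => inferInstanceAs (DecidableEq ({j // j ∈ SA (i + 1)} ⊕ ιE i))

/-- The splitting of the indices of the basis of `C_i` into those of `D_i^B ⊕ E_i`, labelled by
`D_{i+1}^A ⊕ E_i`, and those of `D_i^A ⊕ E_{i-1}`. -/
def selEquiv (f : ∀ i, {j // j ∈ SA (i + 1)} ⊕ {j // j ∈ SA i} ≃ ιD i) :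
    ∀ i, selIdx SA ιE (i + 1) ⊕ selIdx SA ιE i ≃ blkIdx (ιD := ιD) (ιE := ιE) i
  | 0 => (Equiv.sumSumSumComm _ (ιE 0) _ (Fin 0)).trans (Equiv.sumCongr (f 0) (Equiv.refl _))
  | (i + 1) => (Equiv.sumSumSumComm _ (ιE (i + 1)) _ (ιE i)).trans
      (Equiv.sumCongr (f (i + 1)) (Equiv.refl _))

end BlockBasis

section Block

variable {t : F} {D E : ℕ → Type} [∀ i, AddCommGroup (D i)] [∀ i, Module F (D i)]
  [∀ i, AddCommGroup (E i)] [∀ i, Module F (E i)]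
  {ιD ιE : ℕ → Type} (bD : ∀ i, Basis (ιD i) F (D i)) (bE : ∀ i, Basis (ιE i) F (E i))
  (N : ∀ i, D (i + 1) →ₗ[F] D i) (M : ∀ i, D (i + 1) →ₗ[F] E i)
  (W : ∀ i, E i →ₗ[F] D i) (dS : ∀ i, E (i + 1) →ₗ[F] E i) (φ : ∀ i, E i →ₗ[F] E i)
  {SA : ∀ i, Finset (ιD i)}

/-- The block of the differential `∂_{i+1}` of `C_*` that maps `D_{i+1}^A ⊕ E_i` to
`D_i^B ⊕ E_i`. -/
theorem chainBlock_blkD (f : ∀ i, {j // j ∈ SA (i + 1)} ⊕ {j // j ∈ SA i} ≃ ιD i)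
    (hf : ∀ i k, f i (Sum.inr k) = k) (i : ℕ) :
    (chainBlock F (blkC F D E) (blkD F t D E N M W dS φ) (α := selIdx SA ιE)
      (fun i => (blkBasis F D E bD bE i).reindex (selEquiv SA f i).symm) i :
        Matrix ({j // j ∈ SA (i + 1)} ⊕ ιE i) ({j // j ∈ SA (i + 1)} ⊕ ιE i) F) =
    Matrix.fromBlocks
      (.of fun k (j : {j // j ∈ SA (i + 1)}) => (bD i).repr (N i (bD (i + 1) j)) (f i (Sum.inl k)))
      (.of fun k y => (bD i).repr (W i (bE i y)) (f i (Sum.inl k)))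
      (.of fun x (j : {j // j ∈ SA (i + 1)}) => (bE i).repr ((-t) • M i (bD (i + 1) j)) x)
      (.of fun x y => (bE i).repr (((LinearMap.id : E i →ₗ[F] E i) - t • φ i) (bE i y)) x) := by
  have hD (i : ℕ) (j : {j // j ∈ SA (i + 1)}) : blkBasis F D E bD bE (i + 1)
      (selEquiv SA f (i + 1) (Sum.inr (Sum.inl j))) =
        ((bD (i + 1) j, 0, 0) : D (i + 1) × E (i + 1) × E i) := by
    change ((bD (i + 1)).prod ((bE (i + 1)).prod (bE i))) (Sum.inl (f (i + 1) (Sum.inr j))) = _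
    rw [hf, Basis.prod_apply]
    rfl
  have hE (i : ℕ) (y : ιE i) : blkBasis F D E bD bE (i + 1)
      (selEquiv SA f (i + 1) (Sum.inr (Sum.inr y))) =
        ((0, 0, bE i y) : D (i + 1) × E (i + 1) × E i) := by
    change ((bD (i + 1)).prod ((bE (i + 1)).prod (bE i))) (Sum.inr (Sum.inr y)) = _
    simp [Basis.prod_apply]
  have hreprD (x : D (i + 1)) (z : E (i + 1)) (y : E i) (k : {j // j ∈ SA (i + 1)}) :
      (blkBasis F D E bD bE i).repr
        (blkD F t D E N M W dS φ i ((x, z, y) : D (i + 1) × E (i + 1) × E i))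
        (selEquiv SA f i (Sum.inl (Sum.inl k))) =
      (bD i).repr (N i x + W i y) (f i (Sum.inl k)) := by
    cases i <;> rfl
  have hreprE (x : D (i + 1)) (z : E (i + 1)) (y : E i) (k : ιE i) :
      (blkBasis F D E bD bE i).repr
        (blkD F t D E N M W dS φ i ((x, z, y) : D (i + 1) × E (i + 1) × E i))
        (selEquiv SA f i (Sum.inl (Sum.inr k))) =
      (bE i).repr ((-t) • M i x + dS i z + (y - t • φ i y)) k := by
    cases i <;> rfl
  ext k j
  rw [chainBlock, Matrix.of_apply, Basis.repr_reindex_apply, Basis.reindex_apply, Equiv.symm_symm,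
    Equiv.symm_symm]
  rcases k with k | k <;> rcases j with j | j
  · rw [hD, hreprD]
    simp
  · rw [hE, hreprD]
    simp
  · rw [hD, hreprE]
    simp
  · rw [hE, hreprE]
    simp

end Block

/-- The Schur complement formula for a block matrix with invertible lower right corner
`G`, expressed through linear maps. -/
theorem det_fromBlocks_linearMap {U V X ιU ιV ιX κ : Type} [AddCommGroup U] [Module F U]
    [AddCommGroup V] [Module F V] [AddCommGroup X] [Module F X] [Fintype ιX] [DecidableEq ιX]
    [Fintype κ] [DecidableEq κ] (bU : Basis ιU F U) (bV : Basis ιV F V) (bX : Basis ιX F X)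
    (r : κ → ιV) (c : κ → ιU) (A : U →ₗ[F] V) (B : X →ₗ[F] V) (L : U →ₗ[F] X) (G : X ≃ₗ[F] X) :
    (Matrix.fromBlocks
      (.of fun k j => bV.repr (A (bU (c j))) (r k))
      (.of fun k y => bV.repr (B (bX y)) (r k))
      (.of fun x j => bX.repr (L (bU (c j))) x)
      (.of fun x y => bX.repr (G (bX y)) x)).det =
    LinearMap.det (G : X →ₗ[F] X) *
      (Matrix.of fun k j => bV.repr ((A - B ∘ₗ G.symm.toLinearMap ∘ₗ L) (bU (c j))) (r k)).det := by
  have hG : (Matrix.of fun x y => bX.repr (G (bX y)) x) =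
      LinearMap.toMatrix bX bX (G : X →ₗ[F] X) := by
    ext; simp [LinearMap.toMatrix_apply]
  let _ : Invertible (LinearMap.toMatrix bX bX (G : X →ₗ[F] X)) :=
    ⟨LinearMap.toMatrix bX bX (G.symm : X →ₗ[F] X), by simp [← LinearMap.toMatrix_comp],
      by simp [← LinearMap.toMatrix_comp]⟩
  have hinv : ⅟(LinearMap.toMatrix bX bX (G : X →ₗ[F] X)) =
      LinearMap.toMatrix bX bX (G.symm : X →ₗ[F] X) := rfl
  rw [hG, Matrix.det_fromBlocks₂₂, LinearMap.det_toMatrix, hinv]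
  congr 2
  ext k j
  have hGL : G.symm (L (bU (c j))) =
      ∑ x, (LinearMap.toMatrix bX bX (G.symm : X →ₗ[F] X) *
        Matrix.of fun x j => bX.repr (L (bU (c j))) x) x j • bX x := by
    rw [← bX.sum_repr (G.symm (L (bU (c j))))]
    refine Finset.sum_congr rfl fun x _ => ?_
    congr 1
    have hx := congrFun (LinearMap.toMatrix_mulVec_repr bX bX (G.symm : X →ₗ[F] X)
      (L (bU (c j)))) x
    exact hx.symm
  rw [Matrix.mul_assoc]
  simp only [Matrix.sub_apply, Matrix.of_apply, LinearMap.sub_apply, LinearMap.comp_apply,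
    LinearEquiv.coe_coe, hGL, map_sub, map_sum, map_smul, Finsupp.sub_apply, Finsupp.finsetSum_apply,
    Finsupp.smul_apply, smul_eq_mul]
  rw [Matrix.mul_apply]
  simp [mul_comm]

/-- Let `F` be a field and `t ∈ F`.  For `i = 0, …, n` let `D_i` and `E_i` be based
finite-dimensional `F`-vector spaces (with `E_{-1} = 0` and `E_n = 0`), and set
`C_i := D_i ⊕ E_i ⊕ E_{i-1}` with the induced basis `e`.  Suppose the differential
`∂_i : C_i → C_{i-1}` is given in block form by
`∂_i(d, x, y) = (N_i d + W_i y, -t M_i d + ∂^Σ_i x + (1 - tφ_{i-1}) y, -∂^Σ_{i-1} y)`.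
Assume (i) `(C_*, ∂)` is a chain complex; (ii) it is acyclic; (iii) each `1 - tφ_{i-1}` is
invertible; (iv) there are decompositions `D_i = D_i^A ⊕ D_i^B` into spans of subsets of the
chosen basis of `D_i` such that, with `K_i := N_i + t W_i (1 - tφ_{i-1})⁻¹ M_i : D_i → D_{i-1}`,
the map `π_{D_{i-1}^B} ∘ K_i|_{D_i^A} : D_i^A → D_{i-1}^B` is an isomorphism for every `i`
(for `i = 0` this means `D_0^A = 0`).  Then the Reidemeister torsion satisfies
`τ(C_*, e) = ± Π_{i=1}^n (det(1 - tφ_{i-1}) · det(π_{D_{i-1}^B} ∘ K_i|_{D_i^A}))^{(-1)^i}`. -/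
theorem torsion_eq_prod_det_one_sub_smul_mul_det_K
    (t : F) (n : ℕ) (D E : ℕ → Type)
    [∀ i, AddCommGroup (D i)] [∀ i, Module F (D i)] [∀ i, FiniteDimensional F (D i)]
    [∀ i, AddCommGroup (E i)] [∀ i, Module F (E i)] [∀ i, FiniteDimensional F (E i)]
    (htrivD : ∀ i, n < i → Subsingleton (D i)) (htrivE : ∀ i, n ≤ i → Subsingleton (E i))
    (ιD ιE : ℕ → Type) [∀ i, Fintype (ιD i)] [∀ i, Fintype (ιE i)]
    (bD : ∀ i, Basis (ιD i) F (D i)) (bE : ∀ i, Basis (ιE i) F (E i))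
    (N : ∀ i, D (i + 1) →ₗ[F] D i) (M : ∀ i, D (i + 1) →ₗ[F] E i)
    (W : ∀ i, E i →ₗ[F] D i) (dS : ∀ i, E (i + 1) →ₗ[F] E i) (φ : ∀ i, E i →ₗ[F] E i)
    (hd : ∀ i, (blkD F t D E N M W dS φ i).comp (blkD F t D E N M W dS φ (i + 1)) = 0)
    (hacyc : ∀ i, bdry F (blkC F D E) (blkD F t D E N M W dS φ) i =
      cyc F (blkC F D E) (blkD F t D E N M W dS φ) i)
    (hinv : ∀ i, Function.Bijective ⇑((LinearMap.id : E i →ₗ[F] E i) - t • φ i))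
    (SA SB : ∀ i, Finset (ιD i))
    (hcompl : ∀ i, IsCompl (span F (⇑(bD i) '' ↑(SA i))) (span F (⇑(bD i) '' ↑(SB i))))
    (hSA0 : span F (⇑(bD 0) '' ↑(SA 0)) = ⊥)
    (hbij : ∀ i, Function.Bijective (blkProjK F t D E N M W φ bD SA SB hcompl hinv i)) :
    torsion F (blkC F D E) (blkD F t D E N M W dS φ) n (blkBasis F D E bD bE) =
        ∏ i ∈ Finset.range n,
          (LinearMap.det ((LinearMap.id : E i →ₗ[F] E i) - t • φ i) *
            detMap F (subBasis F (bD (i + 1)) (SA (i + 1))) (subBasis F (bD i) (SB i))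
              (blkProjK F t D E N M W φ bD SA SB hcompl hinv i)) ^ ((-1 : ℤ) ^ (i + 1)) ∨
      torsion F (blkC F D E) (blkD F t D E N M W dS φ) n (blkBasis F D E bD bE) =
        -∏ i ∈ Finset.range n,
          (LinearMap.det ((LinearMap.id : E i →ₗ[F] E i) - t • φ i) *
            detMap F (subBasis F (bD (i + 1)) (SA (i + 1))) (subBasis F (bD i) (SB i))
              (blkProjK F t D E N M W φ bD SA SB hcompl hinv i)) ^ ((-1 : ℤ) ^ (i + 1)) := by
  classical
  have hG (i : ℕ) : LinearMap.det ((LinearMap.id : E i →ₗ[F] E i) - t • φ i) ≠ 0 :=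
    (LinearEquiv.isUnit_det' (LinearEquiv.ofBijective _ (hinv i))).ne_zero
  let bA (i : ℕ) := subBasis F (bD (i + 1)) (SA (i + 1))
  let bB (i : ℕ) := subBasis F (bD i) (SB i)
  let K (i : ℕ) := LinearEquiv.ofBijective _ (hbij i)
  let ρ (i : ℕ) : {j // j ∈ SA (i + 1)} ≃ {j // j ∈ SB i} := ((bA i).map (K i)).indexEquiv (bB i)
  let f (i : ℕ) : {j // j ∈ SA (i + 1)} ⊕ {j // j ∈ SA i} ≃ ιD i :=
    (Equiv.sumComm _ _).trans ((Equiv.sumCongr (Equiv.refl _) ((ρ i).trans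
      (Equiv.subtypeEquivRight (mem_iff_notMem_of_isCompl_span F (bD i) (hcompl i))))).trans
        (Equiv.sumCompl (· ∈ SA i)))
  let g (i : ℕ) : Basis (selIdx SA ιE (i + 1) ⊕ selIdx SA ιE i) F (blkC F D E i) :=
    (blkBasis F D E bD bE i).reindex (selEquiv SA f i).symm
  let X (i : ℕ) : F := (chainBlock F (blkC F D E) (blkD F t D E N M W dS φ) g i).det
  have hdetK (i : ℕ) : (((bB i).reindex (ρ i).symm).det ((bA i).map (K i))) =
      (Matrix.of fun k j : {j // j ∈ SA (i + 1)} =>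
        (bD i).repr (blkK F t D E N M W φ hinv i (bD (i + 1) j)) (ρ i k)).det := by
    rw [Basis.det_apply]
    congr 1
    ext k j
    rw [Basis.toMatrix_apply, Basis.repr_reindex_apply, Equiv.symm_symm, Basis.map_apply]
    change (subBasis F (bD i) (SB i)).repr (Submodule.projectionOnto _ _ _ _) _ = _
    rw [subBasis_repr_projectionOnto]
    simp only [LinearMap.comp_apply, Submodule.subtype_apply, bA, coe_subBasis, Matrix.of_apply]
  have hXeq (i : ℕ) : X i = LinearMap.det ((LinearMap.id : E i →ₗ[F] E i) - t • φ i) *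
      ((bB i).reindex (ρ i).symm).det ((bA i).map (K i)) := by
    have hblk := chainBlock_blkD F (t := t) bD bE N M W dS φ f (fun _ _ => rfl) i
    have hdet := det_fromBlocks_linearMap F (bD (i + 1)) (bD i) (bE i) (fun k => (ρ i k : ιD i))
      (fun j : {j // j ∈ SA (i + 1)} => (j : ιD (i + 1))) (N i) (W i) ((-t) • M i)
      (LinearEquiv.ofBijective _ (hinv i))
    have hK : N i - W i ∘ₗ (LinearEquiv.ofBijective _ (hinv i)).symm.toLinearMap ∘ₗ ((-t) • M i) =
        blkK F t D E N M W φ hinv i := by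
      ext x
      simp [blkK]
    rw [hK, ← hdetK] at hdet
    exact (congrArg Matrix.det hblk).trans hdet
  have hX (i : ℕ) : X i ≠ 0 := by
    rw [hXeq]
    refine mul_ne_zero (hG i) ?_
    exact (Basis.isUnit_det _ _).ne_zero
  have hXsq (i : ℕ) : X i ^ 2 = (LinearMap.det ((LinearMap.id : E i →ₗ[F] E i) - t • φ i) *
      detMap F (bA i) (bB i) (blkProjK F t D E N M W φ bD SA SB hcompl hinv i)) ^ 2 := by
    rw [hXeq, mul_pow, mul_pow, detMap, detFam_sq_s6 F _ _ (ρ i) (Equiv.refl _)]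
    congr!
  have hSA_empty : IsEmpty {j // j ∈ SA 0} := by
    refine ⟨fun j => (bD 0).ne_zero j ?_⟩
    rw [← Submodule.mem_bot F, ← hSA0]
    exact subset_span ⟨j, j.2, rfl⟩
  have : IsEmpty (selIdx SA ιE 0) := inferInstanceAs (IsEmpty ({j // j ∈ SA 0} ⊕ Fin 0))
  have : IsEmpty (selIdx SA ιE (n + 1)) := by
    have := htrivD (n + 1) n.lt_succ_self
    have := htrivE n le_rfl
    have : IsEmpty (ιD (n + 1)) := ⟨fun j => (bD _).ne_zero j (Subsingleton.elim _ _)⟩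
    have : IsEmpty (ιE n) := ⟨fun j => (bE _).ne_zero j (Subsingleton.elim _ _)⟩
    exact inferInstanceAs (IsEmpty ({j // j ∈ SA (n + 1)} ⊕ ιE n))
  have hhml (i : ℕ) : Subsingleton (hml F (blkC F D E) (blkD F t D E N M W dS φ) i) := by
    rw [Submodule.Quotient.subsingleton_iff, hacyc, Submodule.comap_subtype_self]
  have (i : ℕ) : IsEmpty
      (Fin (finrank F (hml F (blkC F D E) (blkD F t D E N M W dS φ) i))) := by
    rw [Module.finrank_zero_of_subsingleton]
    infer_instance
  rw [← sq_eq_sq_iff_eq_or_eq_neg, _root_.torsion, if_pos hacyc,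
    sq_torsionHat_eq_prod_det_chainBlock F (g := g) _ (selEquiv SA f) (fun _ => rfl) _ hacyc hX,
    ← Finset.prod_pow, ← Finset.prod_pow]
  refine Finset.prod_congr rfl fun i _ => ?_
  rw [← zpow_natCast, ← zpow_natCast, zpow_comm, zpow_comm (_ * _), zpow_natCast, zpow_natCast]
  exact congrArg (· ^ ((-1 : ℤ) ^ (i + 1))) (hXsq i)

end
end
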